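/- Let D_n (n ∈ ℕ) and D_∞ be proper subdomains of ℂ containing a common point z₀, and suppose the family {D_n, D_∞} is uniformly regular: for every ε > 0 there exists δ ∈ (0, ε) such that every domain D in the family satisfies Hm_D(z, B(z, ε)) > 1 − ε for all z ∈ D with dist(z, ∂D) < δ. If D_n → D_∞ in the Carathéodory kernel sense with respect to z₀, then the harmonic measures Hm_{D_n}(z₀, ·) converge weakly to Hm_{D_∞}(z₀, ·). -/

import Mathlib

open MeasureTheory Filter

/-- The complex upper half-plane. -/
def UH : Set ℂ := {z | 0 < z.im}

/-- A planar Brownian motion with sample space `Ω`: a family of probability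
measures `P w` (the law of Brownian motion started at `w`), with continuous
paths, Gaussian increments and independent increments. -/
structure PlanarBM (Ω : Type*) [MeasurableSpace Ω] where
  Z : ℝ → Ω → ℂ
  P : ℂ → Measure Ω
  isProb : ∀ w, IsProbabilityMeasure (P w)
  meas : ∀ t, Measurable (Z t)
  start : ∀ w, ∀ᵐ ω ∂P w, Z 0 ω = w
  contPaths : ∀ w, ∀ᵐ ω ∂P w, Continuous fun t => Z t ω
  incrLaw : ∀ (w : ℂ) (s t : ℝ), 0 ≤ s → s ≤ t →
    (P w).map (fun ω => Z t ω - Z s ω) =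
      (((ProbabilityTheory.gaussianReal 0 (Real.toNNReal (t - s))).prod
        (ProbabilityTheory.gaussianReal 0 (Real.toNNReal (t - s)))).map
        fun p : ℝ × ℝ => Complex.equivRealProd.symm p)
  indepIncr : ∀ (w : ℂ) (s t : ℝ), 0 ≤ s → s ≤ t →
    ProbabilityTheory.IndepFun (fun ω => Z t ω - Z s ω)
      (fun ω => fun u : Set.Iic s => Z u.1 ω) (P w)

/-- First hitting time of the set `A` by the path `f` (∞ if never hit). -/
noncomputable def hitTime (f : ℝ → ℂ) (A : Set ℂ) : ENNReal :=
  sInf (ENNReal.ofReal '' {t : ℝ | 0 ≤ t ∧ f t ∈ A})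

/-- First exit time of the path `f` from the set `D`. -/
noncomputable def exitTime (f : ℝ → ℂ) (D : Set ℂ) : ENNReal :=
  hitTime f Dᶜ

/-- The path `f` exits the domain `D` (in finite time) through the set `B`. -/
def exitsInto (f : ℝ → ℂ) (D B : Set ℂ) : Prop :=
  ∃ t : ℝ, 0 ≤ t ∧ ENNReal.ofReal t = exitTime f D ∧ f t ∈ B

/-- Harmonic measure of `B` in `D` seen from `z`: the probability that Brownian
motion started at `z` exits `D` through `B`. -/
noncomputable def Hm {Ω : Type*} [MeasurableSpace Ω] (BM : PlanarBM Ω)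
    (D B : Set ℂ) (z : ℂ) : ENNReal :=
  BM.P z {ω | exitsInto (fun t => BM.Z t ω) D B}

/-- Carathéodory kernel convergence of domains with respect to the point `z₀`. -/
def KernelConvergesTo (D : ℕ → Set ℂ) (Dinf : Set ℂ) (z₀ : ℂ) : Prop :=
  (∀ K : Set ℂ, IsCompact K → K ⊆ Dinf → ∀ᶠ n in Filter.atTop, K ⊆ D n) ∧
  (∀ U : Set ℂ, IsOpen U → IsConnected U → z₀ ∈ U → {n | U ⊆ D n}.Infinite → U ⊆ Dinf)

open scoped Classical in
/-- The exit point of the path `f` from `D` (junk value 0 if `f` never exits). -/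
noncomputable def exitPoint (f : ℝ → ℂ) (D : Set ℂ) : ℂ :=
  if h : ∃ t : ℝ, 0 ≤ t ∧ ENNReal.ofReal t = exitTime f D then f h.choose else 0

/-- The harmonic measure `Hm_D(z, ·)` as a Borel measure on ℂ: the law of the
exit point of Brownian motion started at `z` from `D`. -/
noncomputable def hmMeasure {Ω : Type*} [MeasurableSpace Ω] (BM : PlanarBM Ω)
    (D : Set ℂ) (z : ℂ) : Measure ℂ :=
  (BM.P z).map fun ω => exitPoint (fun t => BM.Z t ω) D

/-- A collection `𝒟` of domains is uniformly regular: for any ε > 0 there is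
δ ∈ (0, ε) such that `Hm_D(z, B(z,ε)) > 1 − ε` whenever `z ∈ D ∈ 𝒟` is within
distance δ of `∂D`. -/
def UniformlyRegular {Ω : Type*} [MeasurableSpace Ω] (BM : PlanarBM Ω)
    (𝒟 : Set (Set ℂ)) : Prop :=
  ∀ ε : ℝ, 0 < ε → ∃ δ : ℝ, 0 < δ ∧ δ < ε ∧ ∀ D ∈ 𝒟, ∀ z ∈ D,
    Metric.infDist z (frontier D) < δ →
      ENNReal.ofReal (1 - ε) < Hm BM D (Metric.ball z ε) z

/-- `t` is the first exit time of the path `f` from `D`, and it is attained. -/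
def IsFirstExit (f : ℝ → ℂ) (D : Set ℂ) (t : ℝ) : Prop :=
  0 ≤ t ∧ f t ∉ D ∧ ∀ s, 0 ≤ s → s < t → f s ∈ D

theorem IsFirstExit.unique {f : ℝ → ℂ} {D : Set ℂ} {s t : ℝ} (hs : IsFirstExit f D s)
    (ht : IsFirstExit f D t) : s = t := by
  rcases lt_trichotomy s t with h | h | h
  · exact absurd (ht.2.2 s hs.1 h) hs.2.1
  · exact h
  · exact absurd (hs.2.2 t ht.1 h) ht.2.1

theorem exists_isFirstExit_le {f : ℝ → ℂ} {D : Set ℂ} (hf : Continuous f) (hD : IsOpen D) {t : ℝ}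
    (ht : 0 ≤ t) (hft : f t ∉ D) : ∃ s ≤ t, IsFirstExit f D s := by
  let S : Set ℝ := Set.Icc 0 t ∩ f ⁻¹' Dᶜ
  have hSc : IsCompact S := isCompact_Icc.inter_right (hD.isClosed_compl.preimage hf)
  obtain ⟨s, hs⟩ := hSc.exists_isLeast ⟨t, ⟨ht, le_rfl⟩, hft⟩
  refine ⟨s, hs.1.1.2, hs.1.1.1, hs.1.2, fun u hu0 hus => ?_⟩
  by_contra hu
  exact absurd (hs.2 ⟨⟨hu0, hus.le.trans hs.1.1.2⟩, hu⟩) (not_le.2 hus)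

theorem ofReal_eq_exitTime_iff {f : ℝ → ℂ} {D : Set ℂ} (hf : Continuous f) (hD : IsOpen D)
    {t : ℝ} : (0 ≤ t ∧ ENNReal.ofReal t = exitTime f D) ↔ IsFirstExit f D t := by
  have key : ∀ {s}, IsFirstExit f D s → exitTime f D = ENNReal.ofReal s := by
    intro s hs
    refine le_antisymm (sInf_le ⟨s, ⟨hs.1, hs.2.1⟩, rfl⟩) (le_sInf ?_)
    rintro _ ⟨u, ⟨hu0, hu⟩, rfl⟩
    refine ENNReal.ofReal_le_ofReal (not_lt.1 fun h => hu (hs.2.2 u hu0 h))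
  constructor
  · rintro ⟨ht, h⟩
    have hne : ∃ u, 0 ≤ u ∧ f u ∉ D := by
      by_contra! hcon
      have : {u : ℝ | 0 ≤ u ∧ f u ∈ Dᶜ} = ∅ :=
        Set.eq_empty_of_forall_notMem fun u hu => hu.2 (hcon u hu.1)
      rw [exitTime, hitTime, this] at h
      simp at h
    obtain ⟨u, hu0, hu⟩ := hne
    obtain ⟨s, -, hs⟩ := exists_isFirstExit_le hf hD hu0 hu
    rw [key hs, ENNReal.ofReal_eq_ofReal_iff ht hs.1] at h
    exact h ▸ hs
  · exact fun h => ⟨h.1, (key h).symm⟩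

theorem exitsInto_iff {f : ℝ → ℂ} {D B : Set ℂ} (hf : Continuous f) (hD : IsOpen D) :
    exitsInto f D B ↔ ∃ t, IsFirstExit f D t ∧ f t ∈ B := by
  simp only [exitsInto, ← and_assoc, ofReal_eq_exitTime_iff hf hD]

theorem exitPoint_eq {f : ℝ → ℂ} {D : Set ℂ} (hf : Continuous f) (hD : IsOpen D) {t : ℝ}
    (ht : IsFirstExit f D t) : exitPoint f D = f t := by
  have h : ∃ t : ℝ, 0 ≤ t ∧ ENNReal.ofReal t = exitTime f D :=
    ⟨t, (ofReal_eq_exitTime_iff hf hD).2 ht⟩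
  rw [exitPoint, dif_pos h, ((ofReal_eq_exitTime_iff hf hD).1 h.choose_spec).unique ht]

theorem exitPoint_eq_zero {f : ℝ → ℂ} {D : Set ℂ} (hf : Continuous f) (hD : IsOpen D)
    (h : ¬ ∃ t, IsFirstExit f D t) : exitPoint f D = 0 := by
  rw [exitPoint, dif_neg]
  simpa only [ofReal_eq_exitTime_iff hf hD] using h

theorem exists_nnrat_between {a b : ℝ} (ha : 0 ≤ a) (hab : a < b) :
    ∃ q : ℚ≥0, a < (q : ℝ) ∧ (q : ℝ) < b := by
  obtain ⟨q, h1, h2⟩ := exists_rat_btwn hab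
  have hq : 0 ≤ q := by exact_mod_cast (ha.trans h1.le)
  exact ⟨⟨q, hq⟩, h1, h2⟩

/-- A continuous path leaves an open set by time `t` iff it comes arbitrarily close to the
complement at rational times before `t`. -/
theorem exists_isFirstExit_le_iff {f : ℝ → ℂ} {D : Set ℂ} (hf : Continuous f) (hD : IsOpen D)
    (hne : Dᶜ.Nonempty) (h0 : f 0 ∈ D) {t : ℝ} (ht : 0 ≤ t) : (∃ s ≤ t, IsFirstExit f D s) ↔
      ∀ k : ℕ, ∃ q : ℚ≥0, (q : ℝ) ≤ t ∧ Metric.infDist (f q) Dᶜ < 1 / (k + 1) := by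
  have hd : Continuous fun s => Metric.infDist (f s) Dᶜ := (Metric.continuous_infDist_pt _).comp hf
  constructor
  · rintro ⟨s, hst, hs⟩ k
    have hs0 : 0 < s := lt_of_le_of_ne hs.1 fun h => hs.2.1 (h ▸ h0)
    have hz : Metric.infDist (f s) Dᶜ < 1 / (k + 1) := by
      rw [Metric.infDist_zero_of_mem hs.2.1]; positivity
    obtain ⟨l, hl, hls⟩ := exists_Ioc_subset_of_mem_nhds (hd.continuousAt.eventually_lt
      continuousAt_const hz) ⟨0, hs0⟩
    obtain ⟨q, hq1, hq2⟩ := exists_nnrat_between (le_max_right l 0) (max_lt hl hs0)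
    exact ⟨q, hq2.le.trans hst, hls ⟨(le_max_left _ _).trans_lt hq1, hq2.le⟩⟩
  · intro h
    obtain ⟨s, hs, hmin⟩ := isCompact_Icc.exists_isMinOn ⟨0, le_rfl, ht⟩ hd.continuousOn
      (s := Set.Icc 0 t)
    have hz : Metric.infDist (f s) Dᶜ = 0 := by
      refine le_antisymm (le_of_forall_pos_le_add fun ε hε => ?_) Metric.infDist_nonneg
      obtain ⟨k, hk⟩ := exists_nat_one_div_lt hε
      obtain ⟨q, hq, hqk⟩ := h k
      have := hmin (show (q : ℝ) ∈ Set.Icc 0 t from ⟨by positivity, hq⟩)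
      simp only [Set.mem_ofPred_eq] at this
      linarith
    obtain ⟨u, hu, hu'⟩ := exists_isFirstExit_le hf hD hs.1
      ((hD.isClosed_compl.mem_iff_infDist_zero hne).2 hz)
    exact ⟨u, hu.trans hs.2, hu'⟩

/-- A description, through countably many conditions at rational times, of the event that a
continuous path leaves `D` through the ball of centre `c` and radius `ε`. -/
def RatExitsBall (x : ℚ≥0 → ℂ) (D : Set ℂ) (c : ℂ) (ε : ℝ) : Prop :=
  ∃ N m : ℕ, ∀ k : ℕ, ∃ q : ℚ≥0, (q : ℝ) ≤ N ∧ dist (x q) c ≤ ε - 1 / (m + 1) ∧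
    Metric.infDist (x q) Dᶜ < 1 / (k + 1) ∧
    ∃ j : ℕ, ∀ s : ℚ≥0, s ≤ q → 1 / ((j : ℝ) + 1) ≤ Metric.infDist (x s) Dᶜ

theorem ratExitsBall_iff {f : ℝ → ℂ} {D : Set ℂ} (hf : Continuous f) (hD : IsOpen D)
    (hne : Dᶜ.Nonempty) (h0 : f 0 ∈ D) (c : ℂ) (ε : ℝ) :
    RatExitsBall (fun q => f q) D c ε ↔ exitsInto f D (Metric.ball c ε) := by
  have hd : Continuous fun s => Metric.infDist (f s) Dᶜ := (Metric.continuous_infDist_pt _).comp hf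
  have hmem : ∀ z, z ∉ D ↔ Metric.infDist z Dᶜ = 0 := fun z =>
    hD.isClosed_compl.mem_iff_infDist_zero hne
  rw [exitsInto_iff hf hD]
  constructor
  · rintro ⟨N, m, h⟩
    choose q hqN hqc hqk j hj using h
    obtain ⟨t, ht, φ, hφ, hlim⟩ := isCompact_Icc.tendsto_subseq
      (fun k => (⟨by positivity, hqN k⟩ : (q k : ℝ) ∈ Set.Icc (0 : ℝ) N))
    have hlimd : Tendsto (fun k => Metric.infDist (f (q (φ k))) Dᶜ) atTop
        (nhds (Metric.infDist (f t) Dᶜ)) := (hd.tendsto t).comp hlim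
    have hzero : Tendsto (fun k => Metric.infDist (f (q (φ k))) Dᶜ) atTop (nhds 0) :=
      squeeze_zero (fun _ => Metric.infDist_nonneg) (fun k => (hqk (φ k)).le)
        (tendsto_one_div_add_atTop_nhds_zero_nat.comp hφ.tendsto_atTop)
    have hft : f t ∉ D := (hmem _).2 (tendsto_nhds_unique hlimd hzero)
    have hpre : ∀ k, ∀ s, 0 ≤ s → s < (q k : ℝ) → f s ∈ D := by
      intro k s hs0 hsq
      by_contra hcon
      have hz := (hmem _).1 hcon
      have hlt : Metric.infDist (f s) Dᶜ < 1 / ((j k : ℝ) + 1) := by rw [hz]; positivity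
      obtain ⟨u, hu, hus⟩ := exists_Ico_subset_of_mem_nhds (hd.continuousAt.eventually_lt
        continuousAt_const hlt) ⟨q k, hsq⟩
      obtain ⟨r, hr1, hr2⟩ := exists_nnrat_between hs0 (lt_min hu hsq)
      have h1 := hj k r (by exact_mod_cast (hr2.le.trans (min_le_right _ _)))
      have h2 : Metric.infDist (f r) Dᶜ < 1 / ((j k : ℝ) + 1) :=
        hus ⟨hr1.le, hr2.trans_le (min_le_left _ _)⟩
      linarith
    refine ⟨t, ⟨ht.1, hft, fun s hs0 hst => ?_⟩, ?_⟩
    · obtain ⟨k, hk⟩ := (hlim.eventually_const_lt hst).exists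
      exact hpre _ s hs0 hk
    · have : dist (f t) c ≤ ε - 1 / (m + 1) :=
        le_of_tendsto (((hf.dist continuous_const).tendsto t).comp hlim)
          (Eventually.of_forall fun k => hqc (φ k))
      have h1 : (0 : ℝ) < 1 / (m + 1) := by positivity
      exact Metric.mem_ball.2 (by linarith)
  · rintro ⟨t, ht, htc⟩
    have ht0 : 0 < t := lt_of_le_of_ne ht.1 fun h => ht.2.1 (h ▸ h0)
    obtain ⟨N, hN⟩ := exists_nat_ge t
    obtain ⟨m, hm⟩ := exists_nat_one_div_lt (sub_pos.2 (Metric.mem_ball.1 htc))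
    refine ⟨N, m, fun k => ?_⟩
    have hz : Metric.infDist (f t) Dᶜ < 1 / (k + 1) := by
      rw [(hmem _).1 ht.2.1]; positivity
    have hc : dist (f t) c < ε - 1 / (m + 1) := by linarith
    obtain ⟨l, hl, hls⟩ := exists_Ioc_subset_of_mem_nhds
      ((hd.continuousAt.eventually_lt continuousAt_const hz).and
        ((hf.dist continuous_const).continuousAt.eventually_lt continuousAt_const hc)) ⟨0, ht0⟩
    obtain ⟨q, hq1, hq2⟩ := exists_nnrat_between (le_max_right l 0) (max_lt hl ht0)
    have hq := hls ⟨(le_max_left _ _).trans_lt hq1, hq2.le⟩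
    refine ⟨q, hq2.le.trans hN, hq.2.le, hq.1, ?_⟩
    obtain ⟨s, hs, hmin⟩ := isCompact_Icc.exists_isMinOn
      (⟨0, le_rfl, by positivity⟩ : (Set.Icc (0 : ℝ) q).Nonempty) hd.continuousOn
    have hpos : 0 < Metric.infDist (f s) Dᶜ := lt_of_le_of_ne Metric.infDist_nonneg fun h =>
      (hmem _).2 h.symm (ht.2.2 s hs.1 (hs.2.trans_lt hq2))
    obtain ⟨j, hj⟩ := exists_nat_one_div_lt hpos
    refine ⟨j, fun r hr => hj.le.trans (hmin ⟨by positivity, by exact_mod_cast hr⟩)⟩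

theorem measurableSet_ratExitsBall (D : Set ℂ) (ε : ℝ) :
    MeasurableSet {p : ℂ × (ℚ≥0 → ℂ) | RatExitsBall (fun q => p.1 + p.2 q) D p.1 ε} := by
  simp only [RatExitsBall, Set.ofPred_exists, Set.ofPred_forall, Set.ofPred_and]
  refine .iUnion fun N => .iUnion fun m => .iInter fun k => .iUnion fun q => ?_
  have hq : ∀ q : ℚ≥0, Measurable fun p : ℂ × (ℚ≥0 → ℂ) => p.1 + p.2 q := fun q => by fun_prop
  refine .inter (.const _) (.inter ?_ (.inter ?_ (.iUnion fun j => .iInter fun s => .iInter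
    fun _ => ?_)))
  · exact measurableSet_le ((hq q).dist measurable_fst) measurable_const
  · exact measurableSet_lt (measurable_infDist.comp (hq q)) measurable_const
  · exact measurableSet_le measurable_const (measurable_infDist.comp (hq s))

/-- The law of the increment of planar Brownian motion over a time interval of length `t`. -/
noncomputable def gaussianStep (t : ℝ) : Measure ℂ :=
  ((ProbabilityTheory.gaussianReal 0 (Real.toNNReal t)).prod
    (ProbabilityTheory.gaussianReal 0 (Real.toNNReal t))).map
      fun p : ℝ × ℝ => Complex.equivRealProd.symm p

theorem measurable_equivRealProd_symm :
    Measurable fun p : ℝ × ℝ => Complex.equivRealProd.symm p :=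
  Complex.equivRealProdCLM.symm.continuous.measurable

instance (t : ℝ) : IsProbabilityMeasure (gaussianStep t) :=
  Measure.isProbabilityMeasure_map measurable_equivRealProd_symm.aemeasurable

/-- The σ-algebra generated by a process up to time `s`. -/
@[reducible]
noncomputable def past {Ω : Type*} (X : ℝ → Ω → ℂ) (s : ℝ) : MeasurableSpace Ω :=
  MeasurableSpace.comap (fun ω => fun u : Set.Iic s => X u.1 ω) inferInstance

theorem measurable_past {Ω : Type*} (X : ℝ → Ω → ℂ) {u s : ℝ} (h : u ≤ s) :
    Measurable[past X s] (X u) :=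
  (measurable_pi_apply (X := fun _ : Set.Iic s => ℂ) ⟨u, h⟩).comp
    (comap_measurable fun ω => fun v : Set.Iic s => X v.1 ω)

theorem past_mono {Ω : Type*} (X : ℝ → Ω → ℂ) {s t : ℝ} (h : s ≤ t) : past X s ≤ past X t := by
  refine Measurable.comap_le ?_
  exact @measurable_pi_lambda _ _ _ (past X t) _ _ fun u => measurable_past X (u.2.trans h)

theorem past_le {Ω : Type*} [m : MeasurableSpace Ω] {X : ℝ → Ω → ℂ} (hX : ∀ t, Measurable (X t))
    (s : ℝ) : past X s ≤ m :=
  Measurable.comap_le (measurable_pi_lambda _ fun u => hX u)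

/-- `X` is a planar Brownian motion started at `z` under `P`, all of whose paths are continuous
and start at `z`. -/
structure IsPlanarBM {Ω : Type*} [MeasurableSpace Ω] (P : Measure Ω) (X : ℝ → Ω → ℂ) (z : ℂ) :
    Prop where
  meas : ∀ t, Measurable (X t)
  start : ∀ ω, X 0 ω = z
  cont : ∀ ω, Continuous fun t => X t ω
  incrLaw : ∀ s t : ℝ, 0 ≤ s → s ≤ t → P.map (fun ω => X t ω - X s ω) = gaussianStep (t - s)
  indep : ∀ s t : ℝ, 0 ≤ s → s ≤ t → ProbabilityTheory.IndepFun (fun ω => X t ω - X s ω)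
    (fun ω => fun u : Set.Iic s => X u.1 ω) P

/-- Redefining a planar Brownian motion on a null set makes all its paths continuous. -/
theorem PlanarBM.exists_isPlanarBM {Ω : Type*} [MeasurableSpace Ω] (BM : PlanarBM Ω) (w : ℂ) :
    ∃ X : ℝ → Ω → ℂ, IsPlanarBM (BM.P w) X w ∧ ∀ᵐ ω ∂BM.P w, ∀ t, X t ω = BM.Z t ω := by
  classical
  have hae : ∀ᵐ ω ∂BM.P w, BM.Z 0 ω = w ∧ Continuous fun t => BM.Z t ω :=
    (BM.start w).and (BM.contPaths w)
  set N := toMeasurable (BM.P w) {ω | ¬ (BM.Z 0 ω = w ∧ Continuous fun t => BM.Z t ω)}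
  have hN0 : BM.P w N = 0 := (measure_toMeasurable _).trans hae
  have hN : ∀ ω ∉ N, BM.Z 0 ω = w ∧ Continuous fun t => BM.Z t ω := fun ω hω => by
    by_contra h
    exact hω (subset_toMeasurable _ _ h)
  have hNae : ∀ᵐ ω ∂BM.P w, ω ∉ N := measure_eq_zero_iff_ae_notMem.1 hN0
  refine ⟨fun t ω => if ω ∈ N then w else BM.Z t ω, ⟨fun t => ?_, fun ω => ?_, fun ω => ?_,
    fun s t hs hst => ?_, fun s t hs hst => ?_⟩, ?_⟩
  · exact Measurable.ite (measurableSet_toMeasurable _ _) measurable_const (BM.meas t)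
  · split_ifs with h
    · rfl
    · exact (hN ω h).1
  · split_ifs with h
    · exact continuous_const
    · exact (hN ω h).2
  · rw [gaussianStep, ← BM.incrLaw w s t hs hst]
    refine Measure.map_congr ?_
    filter_upwards [hNae] with ω hω
    simp [hω]
  · refine (BM.indepIncr w s t hs hst).congr ?_ ?_
    · filter_upwards [hNae] with ω hω
      simp [hω]
    · filter_upwards [hNae] with ω hω
      simp [hω]
  · filter_upwards [hNae] with ω hω t
    simp [hω]

/-- The increments of a process after time `s`, at rational times. -/
def relPath {Ω : Type*} (X : ℝ → Ω → ℂ) (s : ℝ) (ω : Ω) : ℚ≥0 → ℂ :=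
  fun q => X (s + q) ω - X s ω

open scoped Classical in
/-- Set to zero all coordinates outside `J`. -/
noncomputable def truncate (J : Finset ℚ≥0) (x : ℚ≥0 → ℂ) : ℚ≥0 → ℂ :=
  fun q => if q ∈ J then x q else 0

theorem measurable_truncate (J : Finset ℚ≥0) : Measurable (truncate J) := by
  refine measurable_pi_lambda _ fun q => ?_
  unfold truncate
  split_ifs
  · exact measurable_pi_apply q
  · exact measurable_const

theorem tendsto_truncate (x : ℚ≥0 → ℂ) : Tendsto (fun J => truncate J x) atTop (nhds x) := by
  refine tendsto_pi_nhds.2 fun q => tendsto_const_nhds.congr' ?_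
  filter_upwards [eventually_ge_atTop {q}] with J hJ
  simp [truncate, Finset.singleton_subset_iff.1 hJ]

theorem measure_eq_of_map_truncate_eq {μ ν : Measure (ℚ≥0 → ℂ)} [IsFiniteMeasure μ]
    [IsFiniteMeasure ν] (h : ∀ J, μ.map (truncate J) = ν.map (truncate J)) : μ = ν := by
  refine ext_of_forall_integral_eq_of_IsFiniteMeasure fun f => ?_
  have key : ∀ (ρ : Measure (ℚ≥0 → ℂ)) [IsFiniteMeasure ρ],
      Tendsto (fun J => ∫ x, f x ∂ρ.map (truncate J)) atTop (nhds (∫ x, f x ∂ρ)) := by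
    intro ρ _
    have : ∀ J, ∫ x, f x ∂ρ.map (truncate J) = ∫ x, f (truncate J x) ∂ρ := fun J =>
      integral_map (measurable_truncate J).aemeasurable f.continuous.aestronglyMeasurable
    simp only [this]
    refine tendsto_integral_filter_of_dominated_convergence (fun _ => ‖f‖) ?_ ?_
      (integrable_const _) ?_
    · exact .of_forall fun J =>
        (f.continuous.measurable.comp (measurable_truncate J)).aestronglyMeasurable
    · exact .of_forall fun J => .of_forall fun x => f.norm_coe_le_norm _
    · exact .of_forall fun x => (f.continuous.tendsto x).comp (tendsto_truncate x)
  have h1 := key μ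
  simp only [h] at h1
  exact tendsto_nhds_unique h1 (key ν)

namespace IsPlanarBM

variable {Ω : Type*} [MeasurableSpace Ω] {P : Measure Ω} {X : ℝ → Ω → ℂ} {z : ℂ}

theorem measurable_relPath (hX : IsPlanarBM P X z) (s : ℝ) : Measurable (relPath X s) :=
  measurable_pi_lambda _ fun _ => (hX.meas _).sub (hX.meas _)

theorem measure_inter_incr (hX : IsPlanarBM P X z) {s t : ℝ} (hs : 0 ≤ s) (hst : s ≤ t)
    {A : Set Ω} (hA : MeasurableSet[past X s] A) {C : Set ℂ} (hC : MeasurableSet C) :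
    P (A ∩ (fun ω => X t ω - X s ω) ⁻¹' C) = P A * gaussianStep (t - s) C := by
  obtain ⟨B, hB, rfl⟩ := hA
  have hm : Measurable fun ω => X t ω - X s ω := (hX.meas t).sub (hX.meas s)
  rw [← hX.incrLaw s t hs hst, Measure.map_apply hm hC, Set.inter_comm,
    (hX.indep s t hs hst).measure_inter_preimage_eq_mul _ _ hC hB, mul_comm]

variable {Ω' : Type*} [MeasurableSpace Ω'] {P' : Measure Ω'} {X' : ℝ → Ω' → ℂ} {z' : ℂ}

theorem map_truncate_insert [IsFiniteMeasure P] (hX : IsPlanarBM P X z) {s : ℝ} (hs : 0 ≤ s)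
    {A : Set Ω} (hA : MeasurableSet[past X s] A) {J : Finset ℚ≥0} {a : ℚ≥0}
    (ha : ∀ q ∈ J, q < a) :
    (P.restrict A).map (fun ω => truncate (insert a J) (relPath X s ω)) =
      (((P.restrict A).map fun ω => truncate J (relPath X s ω)).prod
        (gaussianStep (a - (J.sup id : ℚ≥0)))).map
        fun p : (ℚ≥0 → ℂ) × ℂ => Function.update p.1 a (p.1 (J.sup id) + p.2) := by
  set b := J.sup id with hb
  have hba : (b : ℝ) ≤ a := by
    exact_mod_cast Finset.sup_le fun q hq => (ha q hq).le
  have hmt : Measurable fun ω => truncate J (relPath X s ω) :=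
    (measurable_truncate J).comp (hX.measurable_relPath s)
  have hmd : Measurable fun ω => X (s + a) ω - X (s + b) ω := (hX.meas _).sub (hX.meas _)
  have hmtp : Measurable[past X (s + b)] fun ω => truncate J (relPath X s ω) := by
    refine @measurable_pi_lambda _ _ _ (past X (s + b)) _ _ fun q => ?_
    by_cases hq : q ∈ J
    · have hqb : (q : ℝ) ≤ b := by exact_mod_cast Finset.le_sup (f := id) hq
      simp only [truncate, hq, if_true, relPath]
      exact (measurable_past X (by linarith)).sub (measurable_past X (by
        have : (0 : ℝ) ≤ b := by positivity
        linarith))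
    · simp only [truncate, hq, if_false]
      exact measurable_const
  have hjoint : ((P.restrict A).map fun ω => truncate J (relPath X s ω)).prod
      (gaussianStep (a - b)) = (P.restrict A).map
        fun ω => (truncate J (relPath X s ω), X (s + a) ω - X (s + b) ω) := by
    refine Measure.prod_eq fun C E hC hE => ?_
    rw [Measure.map_apply (hmt.prodMk hmd) (hC.prod hE), Measure.map_apply hmt hC,
      Measure.restrict_apply (hmt hC), Measure.restrict_apply ((hmt.prodMk hmd) (hC.prod hE))]
    have hb0 : (0 : ℝ) ≤ b := by positivity
    have hA' : MeasurableSet[past X (s + b)]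
        ((fun ω => truncate J (relPath X s ω)) ⁻¹' C ∩ A) :=
      MeasurableSet.inter (hmtp hC) (past_mono X (by linarith) _ hA)
    have := hX.measure_inter_incr (s := s + b) (t := s + a) (by linarith) (by linarith) hA' hE
    rw [show s + a - (s + b) = (a : ℝ) - b by ring] at this
    rw [← this]
    congr 1
    ext ω
    simp only [Set.mem_inter_iff, Set.mem_preimage, Set.mem_prod]
    tauto
  have hup : Measurable fun p : (ℚ≥0 → ℂ) × ℂ => Function.update p.1 a (p.1 b + p.2) := by
    refine measurable_pi_lambda _ fun q => ?_
    by_cases hq : q = a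
    · subst hq; simp only [Function.update_self]; fun_prop
    · simp only [Function.update_of_ne hq]; fun_prop
  rw [hjoint, Measure.map_map hup (hmt.prodMk hmd)]
  congr 1
  funext ω q
  have haJ : a ∉ J := fun h => lt_irrefl a (ha a h)
  have hbval : truncate J (relPath X s ω) b = relPath X s ω b := by
    rcases J.eq_empty_or_nonempty with rfl | hJ
    · simp [truncate, relPath, hb]
    · have : b ∈ J := by
        obtain ⟨q, hq, hqb⟩ := Finset.exists_mem_eq_sup J hJ id
        rw [hb, hqb]; exact hq
      simp [truncate, this]
  by_cases hq : q = a
  · subst hq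
    simp only [Function.comp, Function.update_self, hbval]
    simp [truncate, relPath]
  · simp only [Function.comp, Function.update_of_ne hq]
    simp [truncate, hq]

theorem map_truncate_eq [IsProbabilityMeasure P] [IsProbabilityMeasure P']
    (hX : IsPlanarBM P X z) (hX' : IsPlanarBM P' X' z') {s s' : ℝ} (hs : 0 ≤ s) (hs' : 0 ≤ s')
    {A : Set Ω} (hA : MeasurableSet[past X s] A) (J : Finset ℚ≥0) :
    (P.restrict A).map (fun ω => truncate J (relPath X s ω)) =
      P A • P'.map (fun ω => truncate J (relPath X' s' ω)) := by
  induction J using Finset.induction_on_max with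
  | empty =>
    have : ∀ x : ℚ≥0 → ℂ, truncate ∅ x = 0 := fun x => by funext q; simp [truncate]
    simp [this, Measure.map_const]
  | insert a J ha ih =>
    have h2 := hX'.map_truncate_insert hs' (A := Set.univ) MeasurableSet.univ ha
    rw [Measure.restrict_univ] at h2
    rw [hX.map_truncate_insert hs hA ha, h2, ih, Measure.prod_smul_left, Measure.map_smul]

theorem map_relPath_eq [IsProbabilityMeasure P] [IsProbabilityMeasure P']
    (hX : IsPlanarBM P X z) (hX' : IsPlanarBM P' X' z') {s s' : ℝ} (hs : 0 ≤ s) (hs' : 0 ≤ s')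
    {A : Set Ω} (hA : MeasurableSet[past X s] A) :
    (P.restrict A).map (relPath X s) = P A • P'.map (relPath X' s') := by
  have : IsFiniteMeasure (P A • P'.map (relPath X' s')) :=
    Measure.smul_finite _ (measure_ne_top _ _)
  refine measure_eq_of_map_truncate_eq fun J => ?_
  rw [Measure.map_smul, Measure.map_map (measurable_truncate J) (hX.measurable_relPath s),
    Measure.map_map (measurable_truncate J) (hX'.measurable_relPath s')]
  exact hX.map_truncate_eq hX' hs hs' hA J

/-- The Markov property at a deterministic time. -/
theorem measure_inter_relPath [IsProbabilityMeasure P] [IsProbabilityMeasure P']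
    (hX : IsPlanarBM P X z) (hX' : IsPlanarBM P' X' z') {s s' : ℝ} (hs : 0 ≤ s) (hs' : 0 ≤ s')
    {A : Set Ω} (hA : MeasurableSet[past X s] A) {E : Set (ℚ≥0 → ℂ)} (hE : MeasurableSet E) :
    P (A ∩ relPath X s ⁻¹' E) = P A * P'.map (relPath X' s') E := by
  have h := congrArg (fun μ => μ E) (hX.map_relPath_eq hX' hs hs' hA)
  simp only [Measure.smul_apply, smul_eq_mul] at h
  rw [← h, Measure.map_apply (hX.measurable_relPath s) hE,
    Measure.restrict_apply (hX.measurable_relPath s hE), Set.inter_comm]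

end IsPlanarBM

theorem measure_eq_tsum_inter_fiber {Ω : Type*} [MeasurableSpace Ω] (P : Measure Ω) {N : Ω → ℕ}
    (hN : Measurable N) {S : Set Ω} (hS : MeasurableSet S) :
    P S = ∑' j, P (S ∩ N ⁻¹' {j}) := by
  rw [← measure_iUnion _ fun j => hS.inter (hN (measurableSet_singleton j)), ← Set.inter_iUnion]
  · congr 1
    ext ω
    simp
  · intro i j hij
    refine Set.disjoint_left.2 fun ω hi hj => hij ?_
    exact hi.2.symm.trans hj.2

namespace IsPlanarBM

variable {Ω : Type*} [MeasurableSpace Ω] {P : Measure Ω} {X : ℝ → Ω → ℂ} {z : ℂ}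
variable {Ω' : Type*} [MeasurableSpace Ω'] {P' : Measure Ω'} {X' : ℝ → Ω' → ℂ} {z' : ℂ}

theorem measurable_at (hX : IsPlanarBM P X z) {τ : Ω → ℝ} (hτ : Measurable τ) :
    Measurable fun ω => X (τ ω) ω :=
  (measurable_uncurry_of_continuous_of_measurable (u := X) hX.cont hX.meas).comp
    (hτ.prodMk measurable_id)

theorem measurable_relPath_at (hX : IsPlanarBM P X z) {τ : Ω → ℝ} (hτ : Measurable τ) :
    Measurable fun ω => relPath X (τ ω) ω :=
  measurable_pi_lambda _ fun _ => (hX.measurable_at (hτ.add_const _)).sub (hX.measurable_at hτ)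

/-- The Markov property at a random time taking countably many values. -/
theorem measure_inter_discretized [IsProbabilityMeasure P] [IsProbabilityMeasure P']
    (hX : IsPlanarBM P X z) (hX' : IsPlanarBM P' X' z') {N : Ω → ℕ} (hN : Measurable N) {t : ℕ → ℝ}
    (ht : ∀ j, 0 ≤ t j) {A : Set Ω} (hAm : MeasurableSet A)
    (hA : ∀ j, MeasurableSet[past X (t j)] (A ∩ N ⁻¹' {j})) {C : Set ℂ} {E : Set (ℚ≥0 → ℂ)}
    (hC : MeasurableSet C) (hE : MeasurableSet E) :
    P (A ∩ {ω | X (t (N ω)) ω ∈ C ∧ relPath X (t (N ω)) ω ∈ E}) =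
      P (A ∩ {ω | X (t (N ω)) ω ∈ C}) * P'.map (relPath X' 0) E := by
  have htN : Measurable fun ω => t (N ω) := (measurable_of_countable t).comp hN
  have h1 : MeasurableSet {ω | X (t (N ω)) ω ∈ C} := hX.measurable_at htN hC
  have h2 : MeasurableSet {ω | relPath X (t (N ω)) ω ∈ E} := hX.measurable_relPath_at htN hE
  have h12 : MeasurableSet {ω | X (t (N ω)) ω ∈ C ∧ relPath X (t (N ω)) ω ∈ E} := h1.inter h2
  rw [measure_eq_tsum_inter_fiber P hN (hAm.inter h12),
    measure_eq_tsum_inter_fiber P hN (hAm.inter h1), ← ENNReal.tsum_mul_right]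
  refine tsum_congr fun j => ?_
  have hj : MeasurableSet[past X (t j)] (A ∩ N ⁻¹' {j} ∩ X (t j) ⁻¹' C) :=
    MeasurableSet.inter (hA j) (measurable_past X le_rfl hC)
  have := hX.measure_inter_relPath hX' (ht j) le_rfl hj hE
  convert this using 2
  · ext ω
    simp only [Set.mem_inter_iff, Set.mem_preimage, Set.mem_singleton_iff, Set.mem_ofPred_eq]
    constructor
    · rintro ⟨⟨h1, h2, h3⟩, rfl⟩; exact ⟨⟨⟨h1, rfl⟩, h2⟩, h3⟩
    · rintro ⟨⟨⟨h1, rfl⟩, h2⟩, h3⟩; exact ⟨⟨h1, h2, h3⟩, rfl⟩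
  · congr 1
    ext ω
    simp only [Set.mem_inter_iff, Set.mem_preimage, Set.mem_singleton_iff, Set.mem_ofPred_eq]
    constructor
    · rintro ⟨⟨h1, h2⟩, rfl⟩; exact ⟨⟨h1, rfl⟩, h2⟩
    · rintro ⟨⟨h1, rfl⟩, h2⟩; exact ⟨⟨h1, h2⟩, rfl⟩

/-- The strong Markov property. -/
theorem map_strong_markov [IsProbabilityMeasure P] [IsProbabilityMeasure P']
    (hX : IsPlanarBM P X z) (hX' : IsPlanarBM P' X' z') {σ : Ω → ℝ} (hσ : Measurable σ)
    (hσ0 : ∀ ω, 0 ≤ σ ω) {A : Set Ω} (hAm : MeasurableSet A)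
    (hA : ∀ t, 0 ≤ t → MeasurableSet[past X t] (A ∩ {ω | σ ω < t})) :
    (P.restrict A).map (fun ω => (X (σ ω) ω, relPath X (σ ω) ω)) =
      ((P.restrict A).map fun ω => X (σ ω) ω).prod (P'.map (relPath X' 0)) := by
  set μ := P'.map (relPath X' 0) with hμ
  have : IsProbabilityMeasure μ :=
    Measure.isProbabilityMeasure_map (hX'.measurable_relPath 0).aemeasurable
  let N : ℕ → Ω → ℕ := fun k ω => ⌊((k : ℝ) + 1) * σ ω⌋₊
  let t : ℕ → ℕ → ℝ := fun k j => ((j : ℝ) + 1) / ((k : ℝ) + 1)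
  have hN : ∀ k, Measurable (N k) := fun k => Nat.measurable_floor.comp (hσ.const_mul _)
  have ht0 : ∀ k j, 0 ≤ t k j := fun k j => by positivity
  have htN : ∀ k, Measurable fun ω => t k (N k ω) := fun k =>
    (measurable_of_countable (t k)).comp (hN k)
  have hAk : ∀ k j, MeasurableSet[past X (t k j)] (A ∩ N k ⁻¹' {j}) := by
    intro k j
    have hk : (0 : ℝ) < (k : ℝ) + 1 := by positivity
    have heq : A ∩ N k ⁻¹' {j} =
        (A ∩ {ω | σ ω < t k j}) \ (A ∩ {ω | σ ω < (j : ℝ) / ((k : ℝ) + 1)}) := by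
      ext ω
      have hfl : N k ω = j ↔ (j : ℝ) ≤ (k + 1) * σ ω ∧ (k + 1) * σ ω < j + 1 :=
        Nat.floor_eq_iff (mul_nonneg hk.le (hσ0 ω))
      simp only [Set.mem_inter_iff, Set.mem_preimage, Set.mem_singleton_iff, Set.mem_sdiff,
        Set.mem_ofPred_eq, hfl, t, lt_div_iff₀ hk, mul_comm (σ ω)]
      constructor
      · rintro ⟨h1, h2, h3⟩; exact ⟨⟨h1, h3⟩, fun h => absurd h.2 (not_lt.2 h2)⟩
      · rintro ⟨⟨h1, h2⟩, h3⟩; exact ⟨h1, not_lt.1 fun h => h3 ⟨h1, h⟩, h2⟩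
    rw [heq]
    refine MeasurableSet.diff (hA _ (ht0 k j)) (past_mono X ?_ _ (hA _ (by positivity)))
    simp only [t]
    gcongr
    linarith
  have hlim : ∀ ω, Tendsto (fun k => t k (N k ω)) atTop (nhds (σ ω)) := by
    intro ω
    have h1 : Tendsto (fun k : ℕ => σ ω + 1 / ((k : ℝ) + 1)) atTop (nhds (σ ω)) := by
      simpa using (tendsto_const_nhds (x := σ ω)).add
        (tendsto_one_div_add_atTop_nhds_zero_nat (𝕜 := ℝ))
    refine tendsto_of_tendsto_of_tendsto_of_le_of_le tendsto_const_nhds h1 (fun k => ?_)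
      fun k => ?_
    · have hk : (0 : ℝ) < (k : ℝ) + 1 := by positivity
      have := (Nat.lt_floor_add_one (((k : ℝ) + 1) * σ ω)).le
      simp only [t, N, le_div_iff₀ hk]
      linarith
    · have hk : (0 : ℝ) < (k : ℝ) + 1 := by positivity
      have := Nat.floor_le (mul_nonneg hk.le (hσ0 ω))
      simp only [t, N]
      rw [add_div, add_le_add_iff_right, div_le_iff₀ hk]
      linarith
  have hdisc : ∀ k, (P.restrict A).map
      (fun ω => (X (t k (N k ω)) ω, relPath X (t k (N k ω)) ω)) =
        ((P.restrict A).map fun ω => X (t k (N k ω)) ω).prod μ := by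
    intro k
    have hm1 := hX.measurable_at (htN k)
    have hm2 := hX.measurable_relPath_at (htN k)
    refine (Measure.prod_eq fun C E hC hE => ?_).symm
    rw [Measure.map_apply (hm1.prodMk hm2) (hC.prod hE), Measure.map_apply hm1 hC,
      Measure.restrict_apply (hm1 hC), Measure.restrict_apply ((hm1.prodMk hm2) (hC.prod hE)),
      Set.inter_comm, Set.inter_comm _ A]
    exact hX.measure_inter_discretized hX' (hN k) (ht0 k) hAm (hAk k) hC hE
  refine ext_of_forall_integral_eq_of_IsFiniteMeasure fun f => ?_
  have hXlim : ∀ ω, Tendsto (fun k => X (t k (N k ω)) ω) atTop (nhds (X (σ ω) ω)) := fun ω =>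
    ((hX.cont ω).tendsto _).comp (hlim ω)
  have hm1 := hX.measurable_at hσ
  have hm2 := hX.measurable_relPath_at hσ
  have hl : Tendsto (fun k => ∫ x, f x ∂(P.restrict A).map
      (fun ω => (X (t k (N k ω)) ω, relPath X (t k (N k ω)) ω))) atTop
      (nhds (∫ x, f x ∂(P.restrict A).map (fun ω => (X (σ ω) ω, relPath X (σ ω) ω)))) := by
    rw [integral_map (hm1.prodMk hm2).aemeasurable f.continuous.aestronglyMeasurable]
    have hk : ∀ k, _ := fun k => integral_map (μ := P.restrict A) ((hX.measurable_at (htN k)).prodMk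
      (hX.measurable_relPath_at (htN k))).aemeasurable
      (f := f) f.continuous.aestronglyMeasurable
    simp only [hk]
    refine tendsto_integral_of_dominated_convergence (fun _ => ‖f‖) (fun k => ?_)
      (integrable_const _) (fun k => .of_forall fun ω => f.norm_coe_le_norm _)
      (.of_forall fun ω => ?_)
    · exact (f.continuous.measurable.comp ((hX.measurable_at (htN k)).prodMk
        (hX.measurable_relPath_at (htN k)))).aestronglyMeasurable
    · refine (f.continuous.tendsto _).comp ((hXlim ω).prodMk_nhds (tendsto_pi_nhds.2 fun q => ?_))
      exact (((hX.cont ω).tendsto _).comp ((hlim ω).add_const _)).sub (hXlim ω)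
  have hr : Tendsto (fun k => ∫ x, f x ∂((P.restrict A).map
      fun ω => X (t k (N k ω)) ω).prod μ) atTop
      (nhds (∫ x, f x ∂((P.restrict A).map fun ω => X (σ ω) ω).prod μ)) := by
    have hprod : ∀ Y : Ω → ℂ, Measurable Y → ((P.restrict A).map Y).prod μ =
        ((P.restrict A).prod μ).map (Prod.map Y id) := fun Y hY => by
      rw [← Measure.map_prod_map _ _ hY measurable_id, Measure.map_id]
    have hint_eq : ∀ Y : Ω → ℂ, Measurable Y → ∫ x, f x ∂((P.restrict A).map Y).prod μ =
        ∫ p, f (Y p.1, p.2) ∂(P.restrict A).prod μ := fun Y hY => by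
      rw [hprod Y hY, integral_map (hY.prodMap measurable_id).aemeasurable
        f.continuous.aestronglyMeasurable]
      rfl
    rw [hint_eq _ hm1]
    simp only [fun k => hint_eq _ (hX.measurable_at (htN k))]
    refine tendsto_integral_of_dominated_convergence (fun _ => ‖f‖) (fun k => ?_)
      (integrable_const _) (fun k => .of_forall fun ω => f.norm_coe_le_norm _)
      (.of_forall fun p => ?_)
    · exact (f.continuous.measurable.comp (((hX.measurable_at (htN k)).comp
        measurable_fst).prodMk measurable_snd)).aestronglyMeasurable
    · exact (f.continuous.tendsto _).comp ((hXlim p.1).prodMk_nhds tendsto_const_nhds)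
  simp only [hdisc] at hl
  exact tendsto_nhds_unique hl hr

end IsPlanarBM

theorem exitsInto_of_shift {f : ℝ → ℂ} {D B : Set ℂ} (hf : Continuous f) (hD : IsOpen D) {σ : ℝ}
    (hσ : 0 ≤ σ) (hpre : ∀ s, 0 ≤ s → s < σ → f s ∈ D)
    (h : exitsInto (fun t => f (σ + t)) D B) : exitsInto f D B := by
  obtain ⟨t, ⟨ht0, ht, hbefore⟩, htB⟩ := (exitsInto_iff (hf.comp (by fun_prop)) hD).1 h
  refine (exitsInto_iff hf hD).2 ⟨σ + t, ⟨by linarith, ht, fun s hs0 hs => ?_⟩, htB⟩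
  rcases lt_or_ge s σ with h | h
  · exact hpre s hs0 h
  · simpa using hbefore (s - σ) (by linarith) (by linarith)

open scoped Classical in
/-- The first exit time from `D`, with value `0` on paths that never leave `D`. -/
noncomputable def firstExit {Ω : Type*} (X : ℝ → Ω → ℂ) (D : Set ℂ) (ω : Ω) : ℝ :=
  if h : ∃ t, IsFirstExit (fun t => X t ω) D t then h.choose else 0

theorem firstExit_eq {Ω : Type*} {X : ℝ → Ω → ℂ} {D : Set ℂ} {ω : Ω} {t : ℝ}
    (h : IsFirstExit (fun t => X t ω) D t) : firstExit X D ω = t := by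
  have h' : ∃ t, IsFirstExit (fun t => X t ω) D t := ⟨t, h⟩
  rw [firstExit, dif_pos h']
  exact h'.choose_spec.unique h

theorem firstExit_eq_zero {Ω : Type*} {X : ℝ → Ω → ℂ} {D : Set ℂ} {ω : Ω}
    (h : ¬ ∃ t, IsFirstExit (fun t => X t ω) D t) : firstExit X D ω = 0 := by
  rw [firstExit, dif_neg h]

theorem firstExit_nonneg {Ω : Type*} (X : ℝ → Ω → ℂ) (D : Set ℂ) (ω : Ω) :
    0 ≤ firstExit X D ω := by
  by_cases h : ∃ t, IsFirstExit (fun t => X t ω) D t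
  · obtain ⟨t, ht⟩ := h
    exact firstExit_eq ht ▸ ht.1
  · rw [firstExit_eq_zero h]

namespace IsPlanarBM

variable {Ω : Type*} [MeasurableSpace Ω] {P : Measure Ω} {X : ℝ → Ω → ℂ} {z : ℂ} {D : Set ℂ}

theorem measurableSet_exit_le (hX : IsPlanarBM P X z) (hD : IsOpen D) (hne : Dᶜ.Nonempty) {t : ℝ}
    (ht : 0 ≤ t) :
    MeasurableSet[past X t] {ω | ∃ s ≤ t, IsFirstExit (fun t => X t ω) D s} := by
  by_cases hz : z ∈ D
  · have : {ω | ∃ s ≤ t, IsFirstExit (fun t => X t ω) D s} =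
        ⋂ k : ℕ, ⋃ q : ℚ≥0, ⋃ _ : (q : ℝ) ≤ t,
          {ω | Metric.infDist (X q ω) Dᶜ < 1 / ((k : ℝ) + 1)} := by
      ext ω
      simp only [Set.mem_iInter, Set.mem_iUnion, Set.mem_ofPred_eq, exists_prop]
      exact exists_isFirstExit_le_iff (hX.cont ω) hD hne (by rwa [hX.start]) ht
    rw [this]
    refine @MeasurableSet.iInter _ _ (past X t) _ _ fun k => @MeasurableSet.iUnion _ _ (past X t) _ _
      fun q => @MeasurableSet.iUnion _ _ (past X t) _ _ fun hq => ?_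
    exact (measurable_infDist.comp (measurable_past X hq)) measurableSet_Iio
  · have : {ω | ∃ s ≤ t, IsFirstExit (fun t => X t ω) D s} = Set.univ := by
      refine Set.eq_univ_of_forall fun ω => ⟨0, ht, le_rfl, ?_, fun s hs0 hs => ?_⟩
      · simpa only [hX.start] using hz
      · exact absurd hs (not_lt.2 hs0)
    rw [this]
    exact MeasurableSet.univ

theorem measurableSet_exit (hX : IsPlanarBM P X z) (hD : IsOpen D) (hne : Dᶜ.Nonempty) :
    MeasurableSet {ω | ∃ s, IsFirstExit (fun t => X t ω) D s} := by
  have : {ω | ∃ s, IsFirstExit (fun t => X t ω) D s} =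
      ⋃ n : ℕ, {ω | ∃ s ≤ (n : ℝ), IsFirstExit (fun t => X t ω) D s} := by
    ext ω
    simp only [Set.mem_iUnion, Set.mem_ofPred_eq]
    constructor
    · rintro ⟨s, hs⟩
      obtain ⟨n, hn⟩ := exists_nat_ge s
      exact ⟨n, s, hn, hs⟩
    · rintro ⟨n, s, -, hs⟩
      exact ⟨s, hs⟩
  rw [this]
  exact .iUnion fun n => past_le hX.meas _ _ (hX.measurableSet_exit_le hD hne n.cast_nonneg)

theorem measurable_firstExit (hX : IsPlanarBM P X z) (hD : IsOpen D) (hne : Dᶜ.Nonempty) :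
    Measurable (firstExit X D) := by
  refine measurable_of_Iic fun t => ?_
  rcases lt_or_ge t 0 with ht | ht
  · have : firstExit X D ⁻¹' Set.Iic t = ∅ := Set.eq_empty_of_forall_notMem fun ω hω =>
      absurd (firstExit_nonneg X D ω) (not_le.2 (lt_of_le_of_lt hω ht))
    rw [this]
    exact .empty
  · have : firstExit X D ⁻¹' Set.Iic t = {ω | ∃ s ≤ t, IsFirstExit (fun t => X t ω) D s} ∪
        {ω | ∃ s, IsFirstExit (fun t => X t ω) D s}ᶜ := by
      ext ω
      simp only [Set.mem_preimage, Set.mem_Iic, Set.mem_union, Set.mem_compl_iff,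
        Set.mem_ofPred_eq]
      by_cases h : ∃ s, IsFirstExit (fun t => X t ω) D s
      · obtain ⟨s, hs⟩ := h
        rw [firstExit_eq hs]
        exact ⟨fun h => .inl ⟨s, h, hs⟩, fun h => h.elim (fun ⟨u, hu, hu'⟩ => hu'.unique hs ▸ hu)
          fun h => absurd ⟨s, hs⟩ h⟩
      · simp [firstExit_eq_zero h, h, ht]
    rw [this]
    exact (past_le hX.meas _ _ (hX.measurableSet_exit_le hD hne ht)).union
      (hX.measurableSet_exit hD hne).compl

theorem measurable_exitPoint (hX : IsPlanarBM P X z) (hD : IsOpen D) (hne : Dᶜ.Nonempty) :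
    Measurable fun ω => exitPoint (fun t => X t ω) D := by
  classical
  have : (fun ω => exitPoint (fun t => X t ω) D) = fun ω =>
      if ω ∈ {ω | ∃ s, IsFirstExit (fun t => X t ω) D s} then X (firstExit X D ω) ω else 0 := by
    funext ω
    by_cases h : ∃ s, IsFirstExit (fun t => X t ω) D s
    · obtain ⟨s, hs⟩ := h
      rw [exitPoint_eq (hX.cont ω) hD hs, if_pos ⟨s, hs⟩, firstExit_eq hs]
    · rw [exitPoint_eq_zero (hX.cont ω) hD h]
      exact (if_neg h).symm
  rw [this]
  exact Measurable.ite (hX.measurableSet_exit hD hne)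
    (hX.measurable_at (hX.measurable_firstExit hD hne)) measurable_const

theorem measurableSet_past_firstExit_lt (hX : IsPlanarBM P X z) (hD : IsOpen D)
    (hne : Dᶜ.Nonempty) (t : ℝ) :
    MeasurableSet[past X t] ({ω | ∃ s, IsFirstExit (fun t => X t ω) D s} ∩
      {ω | firstExit X D ω < t}) := by
  have this : {ω | ∃ s, IsFirstExit (fun t => X t ω) D s} ∩ {ω | firstExit X D ω < t} =
      ⋃ q : ℚ≥0, ⋃ _ : (q : ℝ) < t, {ω | ∃ s ≤ (q : ℝ), IsFirstExit (fun t => X t ω) D s} := by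
    ext ω
    simp only [Set.mem_inter_iff, Set.mem_iUnion, Set.mem_ofPred_eq, exists_prop]
    constructor
    · rintro ⟨⟨s, hs⟩, hst⟩
      rw [firstExit_eq hs] at hst
      obtain ⟨q, hq1, hq2⟩ := exists_nnrat_between hs.1 hst
      exact ⟨q, hq2, s, hq1.le, hs⟩
    · rintro ⟨q, hq, s, hsq, hs⟩
      exact ⟨⟨s, hs⟩, by rw [firstExit_eq hs]; linarith⟩
  rw [this]
  refine @MeasurableSet.iUnion _ _ (past X t) _ _ fun q => @MeasurableSet.iUnion _ _ (past X t) _ _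
    fun hq => ?_
  exact past_mono X hq.le _ (hX.measurableSet_exit_le hD hne q.cast_nonneg)

theorem measurableSet_exitsInto_ball (hX : IsPlanarBM P X z) (hD : IsOpen D) (hne : Dᶜ.Nonempty)
    (hz : z ∈ D) (ε : ℝ) :
    MeasurableSet {ω | exitsInto (fun t => X t ω) D (Metric.ball z ε)} := by
  have : {ω | exitsInto (fun t => X t ω) D (Metric.ball z ε)} =
      (fun ω => (z, relPath X 0 ω)) ⁻¹' {p | RatExitsBall (fun q => p.1 + p.2 q) D p.1 ε} := by
    ext ω
    simp only [Set.mem_preimage, Set.mem_ofPred_eq,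
      ← ratExitsBall_iff (hX.cont ω) hD hne (by rwa [hX.start]) z ε, relPath, hX.start, zero_add,
      add_sub_cancel]
  rw [this]
  exact (measurable_const.prodMk (hX.measurable_relPath 0)) (measurableSet_ratExitsBall D ε)

/-- If, from every point `w` of `S`, Brownian motion leaves `D` through the ball of centre `w` and
radius `ε` up to probability `η`, then the same is true after the exit time from a smaller
domain `G`. -/
theorem measure_not_exitsInto_le [IsProbabilityMeasure P] (hX : IsPlanarBM P X z) {G S : Set ℂ}
    (hG : IsOpen G) (hGD : G ⊆ D) (hD : IsOpen D) (hne : Dᶜ.Nonempty) (hSD : S ⊆ D)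
    (hS : MeasurableSet S) {ε : ℝ} {η : ENNReal}
    (hη : ∀ w ∈ S, ∃ (P' : Measure Ω) (X' : ℝ → Ω → ℂ), IsProbabilityMeasure P' ∧
      IsPlanarBM P' X' w ∧ P' {ω | ¬ exitsInto (fun t => X' t ω) D (Metric.ball w ε)} ≤ η) :
    P {ω | ∃ t, IsFirstExit (fun t => X t ω) G t ∧ X t ω ∈ S ∧
      ¬ exitsInto (fun t => X t ω) D (Metric.ball (X t ω) ε)} ≤ η := by
  have hneG : Gᶜ.Nonempty := hne.mono (Set.compl_subset_compl.2 hGD)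
  set A := {ω | ∃ s, IsFirstExit (fun t => X t ω) G s}
  have hAm : MeasurableSet A := hX.measurableSet_exit hG hneG
  have hσ := hX.measurable_firstExit hG hneG
  let E : Set (ℂ × (ℚ≥0 → ℂ)) := {p | p.1 ∈ S ∧ ¬ RatExitsBall (fun q => p.1 + p.2 q) D p.1 ε}
  have hE : MeasurableSet E :=
    MeasurableSet.inter (measurable_fst hS) (measurableSet_ratExitsBall D ε).compl
  have hsub : {ω | ∃ t, IsFirstExit (fun t => X t ω) G t ∧ X t ω ∈ S ∧
      ¬ exitsInto (fun t => X t ω) D (Metric.ball (X t ω) ε)} ⊆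
      (fun ω => (X (firstExit X G ω) ω, relPath X (firstExit X G ω) ω)) ⁻¹' E ∩ A := by
    rintro ω ⟨t, ht, htS, hnot⟩
    refine ⟨?_, t, ht⟩
    rw [Set.mem_preimage, firstExit_eq ht]
    refine ⟨htS, fun hrat => hnot (exitsInto_of_shift (hX.cont ω) hD ht.1
      (fun s hs0 hs => hGD (ht.2.2 s hs0 hs)) ?_)⟩
    simp only [relPath, add_sub_cancel] at hrat
    have hc : Continuous fun s => X (t + s) ω := (hX.cont ω).comp (by fun_prop)
    exact (ratExitsBall_iff hc hD hne (by simpa using hSD htS) _ _).1 hrat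
  refine (measure_mono hsub).trans ?_
  have hpair := (hX.measurable_at hσ).prodMk (hX.measurable_relPath_at hσ)
  rw [← Measure.restrict_apply (hpair hE), ← Measure.map_apply hpair hE,
    hX.map_strong_markov hX hσ (firstExit_nonneg X G) hAm
      (fun t _ => hX.measurableSet_past_firstExit_lt hG hneG t), Measure.prod_apply hE]
  have : IsProbabilityMeasure (P.map (relPath X 0)) :=
    Measure.isProbabilityMeasure_map (hX.measurable_relPath 0).aemeasurable
  calc ∫⁻ c, P.map (relPath X 0) (Prod.mk c ⁻¹' E)
        ∂(P.restrict A).map (fun ω => X (firstExit X G ω) ω)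
      ≤ ∫⁻ _, η ∂(P.restrict A).map (fun ω => X (firstExit X G ω) ω) := by
        refine lintegral_mono fun c => ?_
        by_cases hc : c ∈ S
        · obtain ⟨P', X', _, hX', hle⟩ := hη c hc
          have hEc : MeasurableSet (Prod.mk c ⁻¹' E) := measurable_prodMk_left hE
          have h := hX'.measure_inter_relPath hX le_rfl le_rfl (A := Set.univ) .univ hEc
          rw [measure_univ, one_mul, Set.univ_inter] at h
          rw [← h]
          refine (measure_mono ?_).trans hle
          rintro ω ⟨-, hω⟩ hex
          refine hω ?_
          simpa only [relPath, hX'.start, zero_add, add_sub_cancel] using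
            (ratExitsBall_iff (hX'.cont ω) hD hne (by rw [hX'.start]; exact hSD hc) c ε).2 hex
        · have : Prod.mk c ⁻¹' E = ∅ := Set.eq_empty_of_forall_notMem fun x hx => hc hx.1
          simp [this]
    _ ≤ η := by
        rw [lintegral_const, Measure.map_apply (hX.measurable_at hσ) .univ]
        exact mul_le_of_le_one_right' ((Measure.restrict_le_self _).trans prob_le_one)

end IsPlanarBM

theorem PlanarBM.exists_measure_not_exitsInto_le {Ω : Type*} [MeasurableSpace Ω]
    (BM : PlanarBM Ω) {D : Set ℂ} (hD : IsOpen D) (hne : Dᶜ.Nonempty) {w : ℂ} (hw : w ∈ D) {ε : ℝ}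
    (h : ENNReal.ofReal (1 - ε) < Hm BM D (Metric.ball w ε) w) :
    ∃ (P' : Measure Ω) (X' : ℝ → Ω → ℂ), IsProbabilityMeasure P' ∧ IsPlanarBM P' X' w ∧
      P' {ω | ¬ exitsInto (fun t => X' t ω) D (Metric.ball w ε)} ≤ ENNReal.ofReal ε := by
  have := BM.isProb w
  obtain ⟨X, hX, hae⟩ := BM.exists_isPlanarBM w
  refine ⟨BM.P w, X, BM.isProb w, hX, ?_⟩
  have heq : Hm BM D (Metric.ball w ε) w =
      BM.P w {ω | exitsInto (fun t => X t ω) D (Metric.ball w ε)} := by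
    refine measure_congr ?_
    filter_upwards [hae] with ω hω
    have : (fun t => BM.Z t ω) = fun t => X t ω := funext fun t => (hω t).symm
    exact congrArg (fun f => exitsInto f D (Metric.ball w ε)) this
  rw [heq] at h
  have hm := hX.measurableSet_exitsInto_ball hD hne hw ε
  change BM.P w {ω | exitsInto (fun t => X t ω) D (Metric.ball w ε)}ᶜ ≤ _
  rw [prob_compl_eq_one_sub hm, tsub_le_iff_right]
  calc (1 : ENNReal) = ENNReal.ofReal (ε + (1 - ε)) := by simp
    _ ≤ ENNReal.ofReal ε + ENNReal.ofReal (1 - ε) := ENNReal.ofReal_add_le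
    _ ≤ _ := by gcongr

/-- The open axis-parallel square of centre `c` and half side length `r`. -/
def openBox (c : ℂ) (r : ℝ) : Set ℂ := {w | |w.re - c.re| < r ∧ |w.im - c.im| < r}

theorem measurableSet_openBox (c : ℂ) (r : ℝ) : MeasurableSet (openBox c r) := by
  have h1 : MeasurableSet {w : ℂ | |w.re - c.re| < r} :=
    measurableSet_lt (Complex.measurable_re.sub_const _).abs measurable_const
  have h2 : MeasurableSet {w : ℂ | |w.im - c.im| < r} :=
    measurableSet_lt (Complex.measurable_im.sub_const _).abs measurable_const
  exact h1.inter h2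

theorem sub_mem_openBox {a b v w : ℂ} {r s : ℝ} (hv : v ∈ openBox a r) (hw : w ∈ openBox b s) :
    v - w ∈ openBox (a - b) (r + s) := by
  simp only [openBox, Set.mem_ofPred_eq, abs_lt, Complex.sub_re, Complex.sub_im] at *
  refine ⟨⟨?_, ?_⟩, ?_, ?_⟩ <;> linarith [hv.1.1, hv.1.2, hv.2.1, hv.2.2, hw.1.1, hw.1.2, hw.2.1,
    hw.2.2]

theorem openBox_subset_ball (c : ℂ) (r : ℝ) : openBox c r ⊆ Metric.ball c (2 * r) := by
  rintro w ⟨h1, h2⟩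
  rw [Metric.mem_ball, dist_eq_norm]
  have := Complex.norm_le_abs_re_add_abs_im (w - c)
  simp only [Complex.sub_re, Complex.sub_im] at this
  linarith

theorem gaussianStep_openBox (t : ℝ) (c : ℂ) (r : ℝ) :
    gaussianStep t (openBox c r) =
      ProbabilityTheory.gaussianReal 0 (Real.toNNReal t) (Metric.ball c.re r) *
        ProbabilityTheory.gaussianReal 0 (Real.toNNReal t) (Metric.ball c.im r) := by
  rw [gaussianStep, Measure.map_apply measurable_equivRealProd_symm (measurableSet_openBox c r),
    ← Measure.prod_prod]
  congr 1

theorem gaussianStep_one_openBox_pos (c : ℂ) {r : ℝ} (hr : 0 < r) :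
    gaussianStep 1 (openBox c r) ≠ 0 := by
  have key : ∀ a : ℝ, ProbabilityTheory.gaussianReal 0 (Real.toNNReal 1) (Metric.ball a r) ≠ 0 :=
    fun a h => (Metric.measure_ball_pos volume a hr).ne'
      (ProbabilityTheory.gaussianReal_absolutelyContinuous' 0 (by simp) h)
  rw [gaussianStep_openBox]
  exact mul_ne_zero (key _) (key _)

theorem le_gaussianReal_ball {v : NNReal} (hv : 1 ≤ v) (r : ℝ) :
    ENNReal.ofReal ((√(2 * Real.pi * v))⁻¹ * Real.exp (-r ^ 2 / 2)) * ENNReal.ofReal (2 * r) ≤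
      ProbabilityTheory.gaussianReal 0 v (Metric.ball 0 r) := by
  have hv0 : v ≠ 0 := (zero_lt_one.trans_le hv).ne'
  rw [ProbabilityTheory.gaussianReal_apply 0 hv0, ← Real.volume_ball (0 : ℝ), ← setLIntegral_const]
  refine setLIntegral_mono (ProbabilityTheory.measurable_gaussianPDF 0 v) fun x hx => ?_
  rw [ProbabilityTheory.gaussianPDF, ProbabilityTheory.gaussianPDFReal]
  refine ENNReal.ofReal_le_ofReal ?_
  have hx' : x ^ 2 ≤ r ^ 2 := by
    have : |x| < r := by simpa using hx
    exact sq_le_sq' (by linarith [neg_abs_le x]) (by linarith [le_abs_self x])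
  have hv' : (1 : ℝ) ≤ v := by exact_mod_cast hv
  refine mul_le_mul_of_nonneg_left (Real.exp_le_exp.2 ?_) (by positivity)
  rw [sub_zero, neg_div, neg_div, neg_le_neg_iff, div_le_div_iff₀ (by positivity) (by positivity)]
  nlinarith [sq_nonneg x, sq_nonneg r]

theorem le_gaussianStep_openBox {t : ℝ} (ht : 1 ≤ t) {r : ℝ} (hr : 0 < r) :
    ENNReal.ofReal (4 * r ^ 2 * Real.exp (-r ^ 2) / (2 * Real.pi) / t) ≤
      gaussianStep t (openBox 0 r) := by
  have h := le_gaussianReal_ball (v := Real.toNNReal t) (by simpa using ht) r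
  rw [gaussianStep_openBox]
  refine le_trans (le_of_eq ?_) (mul_le_mul' h h)
  rw [← ENNReal.ofReal_mul (by positivity), ← ENNReal.ofReal_mul (by positivity)]
  congr 1
  rw [Real.coe_toNNReal t (by linarith)]
  have h1 : (√(2 * Real.pi * t))⁻¹ * (√(2 * Real.pi * t))⁻¹ = (2 * Real.pi * t)⁻¹ := by
    rw [← mul_inv, Real.mul_self_sqrt (by positivity)]
  have h2 : Real.exp (-r ^ 2 / 2) * Real.exp (-r ^ 2 / 2) = Real.exp (-r ^ 2) := by
    rw [← Real.exp_add]; ring_nf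
  calc 4 * r ^ 2 * Real.exp (-r ^ 2) / (2 * Real.pi) / t
      = (2 * Real.pi * t)⁻¹ * Real.exp (-r ^ 2) * (2 * r) * (2 * r) := by
        rw [mul_inv]; ring
    _ = _ := by rw [← h1, ← h2]; ring

theorem tsum_ofReal_div_eq_top {c : ℝ} (hc : 0 < c) :
    ∑' k : ℕ, ENNReal.ofReal (c / (2 * ((k : ℝ) + 1))) = ⊤ := by
  by_contra h
  have h1 := ENNReal.summable_toReal h
  have h2 : ∀ k : ℕ, (ENNReal.ofReal (c / (2 * ((k : ℝ) + 1)))).toReal =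
      c / 2 * (1 / ((k + 1 : ℕ) : ℝ)) := fun k => by
    rw [ENNReal.toReal_ofReal (by positivity)]
    push_cast
    field_simp
  simp only [h2] at h1
  rw [summable_mul_left_iff (by positivity), summable_nat_add_iff (f := fun n : ℕ => 1 / (n : ℝ)) 1]
    at h1
  exact Real.not_summable_one_div_natCast h1

namespace IsPlanarBM

variable {Ω : Type*} [MeasurableSpace Ω] {P : Measure Ω} {X : ℝ → Ω → ℂ} {z : ℂ}

/-- Planar Brownian motion returns to every neighbourhood of its starting point at some positive
even time. -/
theorem measure_no_return_eq_zero [IsProbabilityMeasure P] (hX : IsPlanarBM P X z) {r : ℝ}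
    (hr : 0 < r) :
    P.map (relPath X 0) {x | ∀ j : ℕ, 1 ≤ j → x (2 * j) ∉ openBox 0 r} = 0 := by
  set E : Set (ℚ≥0 → ℂ) := {x | ∀ j : ℕ, 1 ≤ j → x (2 * j) ∉ openBox 0 r}
  have hE : MeasurableSet E := by
    have : E = ⋂ j : ℕ, ⋂ _ : 1 ≤ j, (fun x : ℚ≥0 → ℂ => x (2 * j)) ⁻¹' (openBox 0 r)ᶜ := by
      ext x; simp [E]
    rw [this]
    exact .iInter fun j => .iInter fun _ =>
      (measurable_pi_apply _) (measurableSet_openBox 0 r).compl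
  let T : ℕ → ℝ := fun k => 2 * ((k : ℝ) + 1)
  have hT : ∀ k, 0 ≤ T k := fun k => by positivity
  let A : ℕ → Set Ω := fun k => (fun ω => X (T k) ω - X 0 ω) ⁻¹' openBox 0 (r / 2)
  have hA : ∀ k, MeasurableSet[past X (T k)] (A k) := fun k =>
    ((measurable_past X le_rfl).sub (measurable_past X (hT k))) (measurableSet_openBox 0 _)
  have hA' : ∀ k : ℕ, ENNReal.ofReal (4 * (r / 2) ^ 2 * Real.exp (-(r / 2) ^ 2) / (2 * Real.pi) /
      (2 * ((k : ℝ) + 1))) ≤ P (A k) := fun k => by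
    have h := hX.measure_inter_incr le_rfl (hT k) (A := Set.univ) .univ
      (measurableSet_openBox 0 (r / 2))
    rw [measure_univ, one_mul, Set.univ_inter, sub_zero] at h
    have hTk : 1 ≤ T k := by
      change (1 : ℝ) ≤ 2 * (k + 1)
      linarith [k.cast_nonneg (α := ℝ)]
    exact (le_gaussianStep_openBox hTk (half_pos hr)).trans h.ge
  have hdisj : Pairwise (Function.onFun Disjoint fun k => A k ∩ relPath X (T k) ⁻¹' E) := by
    have key : ∀ i j : ℕ, i < j → Disjoint (A i ∩ relPath X (T i) ⁻¹' E)
        (A j ∩ relPath X (T j) ⁻¹' E) := by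
      intro i j hij
      refine Set.disjoint_left.2 fun ω hi hj => hi.2 (j - i) (by omega) ?_
      have h := sub_mem_openBox hj.1 hi.1
      rw [sub_zero, add_halves] at h
      convert h using 1
      have : T i + ((2 * ((j - i : ℕ) : ℚ≥0) : ℚ≥0) : ℝ) = T j := by
        simp only [T]
        rw [NNRat.cast_mul, NNRat.cast_natCast, Nat.cast_sub hij.le]
        push_cast
        ring
      simp only [relPath, this]
      ring
    intro i j hij
    rcases lt_or_gt_of_ne hij with h | h
    · exact key i j h
    · exact (key j i h).symm
  have hle : ∑' k, P (A k ∩ relPath X (T k) ⁻¹' E) ≤ 1 := by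
    rw [← measure_iUnion hdisj fun k =>
      (past_le hX.meas _ _ (hA k)).inter (hX.measurable_relPath _ hE)]
    exact prob_le_one
  simp only [fun k => hX.measure_inter_relPath hX (hT k) le_rfl (hA k) hE,
    ENNReal.tsum_mul_right] at hle
  have htop : ∑' k, P (A k) = ⊤ :=
    top_le_iff.1 ((tsum_ofReal_div_eq_top (by positivity)).ge.trans (ENNReal.tsum_le_tsum hA'))
  by_contra hne
  rw [htop, ENNReal.top_mul hne] at hle
  exact absurd hle (by simp)

/-- Planar Brownian motion is neighbourhood recurrent. -/
theorem ae_exists_mem_ball [IsProbabilityMeasure P] (hX : IsPlanarBM P X z) (ζ : ℂ) {ρ : ℝ}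
    (hρ : 0 < ρ) : ∀ᵐ ω ∂P, ∃ n : ℕ, X n ω ∈ Metric.ball ζ ρ := by
  set r := ρ / 4
  have hr : 0 < r := by positivity
  set F : Set (ℚ≥0 → ℂ) := {x | ∀ n : ℕ, x n ∉ openBox (ζ - z) (r + r)}
  have hF : MeasurableSet F := by
    have : F = ⋂ n : ℕ, (fun x : ℚ≥0 → ℂ => x n) ⁻¹' (openBox (ζ - z) (r + r))ᶜ := by
      ext x; simp [F]
    rw [this]
    exact .iInter fun n => (measurable_pi_apply _) (measurableSet_openBox _ _).compl
  have hA : MeasurableSet[past X 1] ((fun ω => X 1 ω - X 0 ω) ⁻¹' openBox (-(ζ - z)) r) :=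
    ((measurable_past X le_rfl).sub (measurable_past X zero_le_one)) (measurableSet_openBox _ _)
  have hmul := hX.measure_inter_relPath hX zero_le_one le_rfl hA hF
  have hzero : P ((fun ω => X 1 ω - X 0 ω) ⁻¹' openBox (-(ζ - z)) r ∩ relPath X 1 ⁻¹' F) = 0 := by
    have h := hX.measure_no_return_eq_zero hr
    have hle := Measure.le_map_apply (hX.measurable_relPath 0).aemeasurable
      {x | ∀ j : ℕ, 1 ≤ j → x (2 * j) ∉ openBox 0 r} (μ := P)
    refine measure_mono_null ?_ (le_antisymm (hle.trans h.le) zero_le)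
    rintro ω ⟨h1, h2⟩ j hj hbox
    refine h2 (2 * j - 1) ?_
    have h := sub_mem_openBox hbox h1
    rw [sub_neg_eq_add, zero_add] at h
    convert h using 1
    have : (1 : ℝ) + (((2 * j - 1 : ℕ) : ℚ≥0) : ℝ) = 0 + ((2 * (j : ℚ≥0) : ℚ≥0) : ℝ) := by
      rw [NNRat.cast_natCast, Nat.cast_sub (by omega)]
      push_cast
      ring
    simp only [relPath, this]
    ring
  rw [hzero] at hmul
  have hstep := hX.measure_inter_incr le_rfl zero_le_one (A := Set.univ) .univ
    (measurableSet_openBox (-(ζ - z)) r)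
  rw [measure_univ, one_mul, Set.univ_inter, sub_zero] at hstep
  have hF0 : P.map (relPath X 0) F = 0 := by
    rcases mul_eq_zero.1 hmul.symm with h | h
    · exact absurd (hstep ▸ h) (gaussianStep_one_openBox_pos _ hr)
    · exact h
  rw [Measure.map_apply (hX.measurable_relPath 0) hF] at hF0
  filter_upwards [measure_eq_zero_iff_ae_notMem.1 hF0] with ω hω
  simp only [F, Set.mem_preimage, Set.mem_ofPred_eq, not_forall, not_not] at hω
  obtain ⟨n, hn⟩ := hω
  refine ⟨n, ?_⟩
  have h := openBox_subset_ball _ _ hn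
  simp only [relPath, hX.start, zero_add, Metric.mem_ball, dist_sub_right] at h
  rw [Metric.mem_ball]
  calc dist (X n ω) ζ < 2 * (r + r) := by simpa using h
    _ = ρ := by simp only [r]; ring

end IsPlanarBM

theorem ball_subset_of_le_infDist_frontier {D : Set ℂ} (hne : D ≠ Set.univ) {ζ : ℂ} (hζ : ζ ∈ D)
    {δ : ℝ} (hδ : δ ≤ Metric.infDist ζ (frontier D)) : Metric.ball ζ δ ⊆ D := by
  obtain ⟨y, hy, hyd⟩ := exists_mem_frontier_infDist_compl_eq_dist hζ hne
  refine (Metric.ball_subset_ball ?_).trans Metric.ball_infDist_compl_subset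
  exact hδ.trans ((Metric.infDist_le_dist_of_mem hy).trans hyd.ge)

/-- A point of a domain can be joined to a given point inside a connected open set whose closure is
a compact subset of the domain. -/
theorem exists_isConnected_subset_isCompact {D : Set ℂ} (hD : IsOpen D) (hc : IsConnected D)
    {z w : ℂ} (hz : z ∈ D) (hw : w ∈ D) :
    ∃ V K : Set ℂ, IsOpen V ∧ IsConnected V ∧ z ∈ V ∧ w ∈ V ∧ V ⊆ K ∧ IsCompact K ∧ K ⊆ D := by
  obtain ⟨γ, hγ⟩ := (hD.isConnected_iff_isPathConnected.1 hc).joinedIn z hz w hw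
  have hcomp : IsCompact (Set.range γ) := isCompact_range γ.continuous
  obtain ⟨r, hr, hsub⟩ := hcomp.exists_cthickening_subset_open hD (Set.range_subset_iff.2 hγ)
  refine ⟨Metric.thickening r (Set.range γ), Metric.cthickening r (Set.range γ),
    Metric.isOpen_thickening, ?_, ?_, ?_, Metric.thickening_subset_cthickening _ _,
    hcomp.cthickening, hsub⟩
  · have h1 : Metric.thickening r (Set.range γ) =
        (fun p : ℂ × ℂ => p.1 + p.2) '' (Set.range γ ×ˢ Metric.ball 0 r) := by
      rw [Set.image_prod, Set.image2_add, add_ball_zero]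
    rw [h1]
    exact ((isConnected_range γ.continuous).prod (Metric.isConnected_ball hr)).image _
      continuous_add.continuousOn
  · exact Metric.self_subset_thickening hr _ ⟨0, γ.source⟩
  · exact Metric.self_subset_thickening hr _ ⟨1, γ.target⟩

namespace KernelConvergesTo

variable {D : ℕ → Set ℂ} {Dinf : Set ℂ} {z₀ : ℂ}

theorem eventually_infDist_frontier_limit_lt (hconv : KernelConvergesTo D Dinf z₀) (R : ℝ) {δ : ℝ}
    (hδ : 0 < δ) : ∀ᶠ n in atTop, ∀ z ∈ Dinf, ‖z‖ ≤ R → z ∉ D n →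
      Metric.infDist z (frontier Dinf) < δ := by
  set K : Set ℂ := Metric.closedBall 0 R ∩
    (closure Dinf ∩ {z | δ ≤ Metric.infDist z (frontier Dinf)}) with hKdef
  have hK : IsCompact K := (isCompact_closedBall 0 R).inter_right
    (isClosed_closure.inter (isClosed_le continuous_const (Metric.continuous_infDist_pt _)))
  have hKD : K ⊆ Dinf := by
    rintro z ⟨-, hz, hzδ⟩
    by_contra hzD
    have : z ∈ frontier Dinf := ⟨hz, fun h => hzD (interior_subset h)⟩
    rw [Set.mem_ofPred_eq, Metric.infDist_zero_of_mem this] at hzδ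
    linarith
  filter_upwards [hconv.1 K hK hKD] with n hn z hz hzR hzn
  by_contra! hlt
  exact hzn (hn ⟨by simpa using hzR, subset_closure hz, hlt⟩)

theorem eventually_infDist_frontier_lt (hconv : KernelConvergesTo D Dinf z₀)
    (hne : ∀ n, D n ≠ Set.univ) (hoinf : IsOpen Dinf) (hcinf : IsConnected Dinf)
    (hz₀inf : z₀ ∈ Dinf) (R : ℝ) {δ : ℝ} (hδ : 0 < δ) :
    ∀ᶠ n in atTop, ∀ ζ ∈ frontier Dinf, ‖ζ‖ ≤ R → ζ ∈ D n →
      Metric.infDist ζ (frontier (D n)) < δ := by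
  by_contra hcon
  rw [not_eventually] at hcon
  obtain ⟨φ, hφ, hbad⟩ := extraction_of_frequently_atTop hcon
  push Not at hbad
  choose u hu huR huD huδ using hbad
  have hcomp : IsCompact (Metric.closedBall (0 : ℂ) R ∩ frontier Dinf) :=
    (isCompact_closedBall 0 R).inter_right isClosed_frontier
  obtain ⟨ζ, hζ, ψ, hψ, hlim⟩ := hcomp.tendsto_subseq
    (x := u) fun n => ⟨by simpa using huR n, hu n⟩
  obtain ⟨w, hwb, hwD⟩ := mem_closure_iff.1 hζ.2.1 _ Metric.isOpen_ball
    (Metric.mem_ball_self (half_pos hδ))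
  obtain ⟨V, K, hVo, hVc, hzV, hwV, hVK, hK, hKD⟩ :=
    exists_isConnected_subset_isCompact hoinf hcinf hz₀inf hwD
  have hsub : ∀ᶠ k in atTop, V ∪ Metric.ball ζ (δ / 2) ⊆ D (φ (ψ k)) := by
    filter_upwards [(hφ.comp hψ).tendsto_atTop.eventually (hconv.1 K hK hKD),
      (Metric.tendsto_nhds.1 hlim) _ (half_pos hδ)] with k hk1 hk2
    refine Set.union_subset (hVK.trans hk1) fun x hx => ?_
    refine ball_subset_of_le_infDist_frontier (hne _) (huD (ψ k)) (huδ (ψ k)) ?_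
    rw [Metric.mem_ball] at hx ⊢
    have h3 := dist_triangle_right x (u (ψ k)) ζ
    simp only [Function.comp_apply] at hk2
    linarith
  have hinf : {n | V ∪ Metric.ball ζ (δ / 2) ⊆ D n}.Infinite := by
    rw [← Nat.frequently_atTop_iff_infinite]
    exact (hφ.comp hψ).tendsto_atTop.frequently hsub.frequently
  have hU := hconv.2 _ (hVo.union Metric.isOpen_ball)
    (hVc.union ⟨w, hwV, hwb⟩ (Metric.isConnected_ball (half_pos hδ))) (Or.inl hzV) hinf
  have hζD : ζ ∈ Dinf := hU (Or.inr (Metric.mem_ball_self (half_pos hδ)))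
  exact (hoinf.frontier_eq ▸ hζ.2).2 hζD

end KernelConvergesTo

namespace IsPlanarBM

variable {Ω : Type*} [MeasurableSpace Ω] {P : Measure Ω} {X : ℝ → Ω → ℂ} {z : ℂ} {BM : PlanarBM Ω}
  {D : Set ℂ}

theorem measure_not_exitsInto_ball_le [IsProbabilityMeasure P] (hX : IsPlanarBM P X z) {G : Set ℂ}
    (hG : IsOpen G) (hGD : G ⊆ D) (hD : IsOpen D) (hne : D ≠ Set.univ) {ε δ : ℝ}
    (h : ∀ w ∈ D, Metric.infDist w (frontier D) < δ →
      ENNReal.ofReal (1 - ε) < Hm BM D (Metric.ball w ε) w) :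
    P {ω | ∃ t, IsFirstExit (fun t => X t ω) G t ∧
      (X t ω ∈ D ∧ Metric.infDist (X t ω) (frontier D) < δ) ∧
      ¬ exitsInto (fun t => X t ω) D (Metric.ball (X t ω) ε)} ≤ ENNReal.ofReal ε := by
  have hne' : Dᶜ.Nonempty := Set.nonempty_compl.2 hne
  have hS : MeasurableSet (D ∩ {w | Metric.infDist w (frontier D) < δ}) :=
    hD.measurableSet.inter (measurableSet_lt (Metric.continuous_infDist_pt _).measurable
      measurable_const)
  exact hX.measure_not_exitsInto_le hG hGD hD hne' Set.inter_subset_left hS fun w hw =>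
    BM.exists_measure_not_exitsInto_le hD hne' hw.1 (h w hw.1 hw.2)

/-- Brownian motion almost surely exits a regular domain. -/
theorem ae_exists_isFirstExit [IsProbabilityMeasure P] (hX : IsPlanarBM P X z) (hD : IsOpen D)
    (hne : D ≠ Set.univ) (hfr : (frontier D).Nonempty)
    (h : ∀ ε : ℝ, 0 < ε → ∃ δ : ℝ, 0 < δ ∧ ∀ w ∈ D, Metric.infDist w (frontier D) < δ →
      ENNReal.ofReal (1 - ε) < Hm BM D (Metric.ball w ε) w) :
    ∀ᵐ ω ∂P, ∃ t, IsFirstExit (fun t => X t ω) D t := by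
  obtain ⟨ζ, hζ⟩ := hfr
  have key : ∀ ε : ℝ, 0 < ε →
      P {ω | ¬ ∃ t, IsFirstExit (fun t => X t ω) D t} ≤ ENNReal.ofReal ε := by
    intro ε hε
    obtain ⟨δ, hδ, hreg⟩ := h ε hε
    refine le_trans (measure_mono_ae ?_) (hX.measure_not_exitsInto_ball_le
      (G := D \ Metric.closedBall ζ (δ / 2)) (hD.sdiff Metric.isClosed_closedBall)
      Set.sdiff_subset hD hne hreg)
    filter_upwards [hX.ae_exists_mem_ball ζ (half_pos hδ)] with ω ⟨n, hn⟩ hω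
    obtain ⟨s, -, hs⟩ := exists_isFirstExit_le (hX.cont ω)
      (hD.sdiff Metric.isClosed_closedBall) n.cast_nonneg
      (fun h => h.2 (Metric.ball_subset_closedBall hn))
    have hsD : X s ω ∈ D := by
      by_contra hcon
      obtain ⟨t, -, ht⟩ := exists_isFirstExit_le (hX.cont ω) hD hs.1 hcon
      exact hω ⟨t, ht⟩
    have hsB : X s ω ∈ Metric.closedBall ζ (δ / 2) := by
      by_contra hcon
      exact hs.2.1 ⟨hsD, hcon⟩
    refine ⟨s, hs, ⟨hsD, ?_⟩, fun hex => ?_⟩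
    · have h1 := Metric.infDist_le_dist_of_mem (x := X s ω) hζ
      have h2 := Metric.mem_closedBall.1 hsB
      linarith
    · obtain ⟨t, ht, -⟩ := (exitsInto_iff (hX.cont ω) hD).1 hex
      exact hω ⟨t, ht⟩
  refine le_antisymm (ENNReal.le_of_forall_pos_le_add fun ε hε _ => ?_) zero_le
  rw [zero_add, ← ENNReal.ofReal_coe_nnreal]
  exact key ε hε

theorem tendsto_measure_not_exit_le [IsProbabilityMeasure P] (hX : IsPlanarBM P X z)
    (hD : IsOpen D) (hne : D ≠ Set.univ)
    (hexit : ∀ᵐ ω ∂P, ∃ t, IsFirstExit (fun t => X t ω) D t) :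
    Tendsto (fun N : ℕ => P {ω | ¬ ∃ s ≤ (N : ℝ), IsFirstExit (fun t => X t ω) D s}) atTop
      (nhds 0) := by
  have h := tendsto_measure_iInter_atTop (μ := P)
    (s := fun N : ℕ => {ω | ¬ ∃ s ≤ (N : ℝ), IsFirstExit (fun t => X t ω) D s})
    (fun N => ((past_le hX.meas _ _ (hX.measurableSet_exit_le hD (Set.nonempty_compl.2 hne)
      N.cast_nonneg)).compl).nullMeasurableSet)
    (fun M N hMN ω hω ⟨s, hs, hs'⟩ => hω ⟨s, hs.trans (Nat.cast_le.2 hMN), hs'⟩)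
    ⟨0, measure_ne_top _ _⟩
  have h0 : P (⋂ N : ℕ, {ω | ¬ ∃ s ≤ (N : ℝ), IsFirstExit (fun t => X t ω) D s}) = 0 := by
    refine measure_mono_null ?_ (ae_iff.1 hexit)
    rintro ω hω ⟨t, ht⟩
    obtain ⟨N, hN⟩ := exists_nat_ge t
    exact Set.mem_iInter.1 hω N ⟨t, hN, ht⟩
  rwa [h0] at h

theorem tendsto_measure_exit_ball_le [IsProbabilityMeasure P] (hX : IsPlanarBM P X z) {T : ℝ}
    (hT : 0 ≤ T) :
    Tendsto (fun R : ℕ => P {ω | ∃ s ≤ T, IsFirstExit (fun t => X t ω) (Metric.ball 0 R) s}) atTop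
      (nhds 0) := by
  have hne : ∀ R : ℕ, (Metric.ball (0 : ℂ) R)ᶜ.Nonempty := fun R => ⟨R, by simp⟩
  have h := tendsto_measure_iInter_atTop (μ := P)
    (s := fun R : ℕ => {ω | ∃ s ≤ T, IsFirstExit (fun t => X t ω) (Metric.ball 0 R) s})
    (fun R => (past_le hX.meas _ _ (hX.measurableSet_exit_le Metric.isOpen_ball (hne R)
      hT)).nullMeasurableSet)
    (fun R R' hR ω ⟨s, hs, hs'⟩ => ?_) ⟨0, measure_ne_top _ _⟩
  · have h0 : (⋂ R : ℕ, {ω | ∃ s ≤ T, IsFirstExit (fun t => X t ω) (Metric.ball 0 R) s}) = ∅ := by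
      refine Set.eq_empty_of_forall_notMem fun ω hω => ?_
      obtain ⟨C, hC⟩ := (isCompact_Icc (a := (0 : ℝ)) (b := T)).exists_bound_of_continuousOn
        (hX.cont ω).continuousOn
      obtain ⟨R, hR⟩ := exists_nat_gt C
      obtain ⟨s, hsT, hs⟩ := Set.mem_iInter.1 hω R
      exact hs.2.1 (mem_ball_zero_iff.2 ((hC s ⟨hs.1, hsT⟩).trans_lt hR))
    rwa [h0, measure_empty] at h
  · obtain ⟨t, hts, ht⟩ := exists_isFirstExit_le (hX.cont ω) (Metric.isOpen_ball (ε := (R : ℝ)))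
      hs'.1 (fun hmem => hs'.2.1 (Metric.ball_subset_ball (Nat.cast_le.2 hR) hmem))
    exact ⟨t, hts.trans hs, ht⟩

end IsPlanarBM

theorem IsFirstExit.of_subset {f : ℝ → ℂ} {G D : Set ℂ} {t : ℝ} (ht : IsFirstExit f G t)
    (hGD : G ⊆ D) (hft : f t ∉ D) : IsFirstExit f D t :=
  ⟨ht.1, hft, fun s hs hst => hGD (ht.2.2 s hs hst)⟩

theorem IsFirstExit.mem_frontier {f : ℝ → ℂ} {D : Set ℂ} {t : ℝ} (ht : IsFirstExit f D t)
    (hf : Continuous f) (hD : IsOpen D) (h0 : f 0 ∈ D) : f t ∈ frontier D := by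
  have htpos : 0 ≠ t := fun h => ht.2.1 (h ▸ h0)
  rw [hD.frontier_eq]
  refine ⟨map_mem_closure hf (s := Set.Ico 0 t) ?_ fun s hs => ht.2.2 s hs.1 hs.2, ht.2.1⟩
  rw [closure_Ico htpos]
  exact ⟨ht.1, le_rfl⟩

theorem dist_exitPoint_lt_of_exitsInto {f : ℝ → ℂ} {D : Set ℂ} (hf : Continuous f) (hD : IsOpen D)
    {x : ℂ} {ε : ℝ} (h : exitsInto f D (Metric.ball x ε)) : dist (exitPoint f D) x < ε := by
  obtain ⟨t, ht, hmem⟩ := (exitsInto_iff hf hD).1 h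
  rwa [exitPoint_eq hf hD ht]

/-- Under kernel convergence of uniformly regular domains, the exit points of a Brownian motion
converge in probability. -/
theorem IsPlanarBM.tendstoInMeasure_exitPoint {Ω : Type*} [MeasurableSpace Ω] {P : Measure Ω}
    [IsProbabilityMeasure P] {X : ℝ → Ω → ℂ} {z₀ : ℂ} (hX : IsPlanarBM P X z₀) {BM : PlanarBM Ω}
    {D : ℕ → Set ℂ} {Dinf : Set ℂ} (hopen : ∀ n, IsOpen (D n)) (hne : ∀ n, D n ≠ Set.univ)
    (hoinf : IsOpen Dinf) (hcinf : IsConnected Dinf) (hneinf : Dinf ≠ Set.univ)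
    (hz₀inf : z₀ ∈ Dinf) (hur : UniformlyRegular BM (Set.range D ∪ {Dinf}))
    (hconv : KernelConvergesTo D Dinf z₀) :
    TendstoInMeasure P (fun n ω => exitPoint (fun t => X t ω) (D n)) atTop
      (fun ω => exitPoint (fun t => X t ω) Dinf) := by
  rw [tendstoInMeasure_iff_dist]
  intro ε' hε'
  rw [ENNReal.tendsto_nhds_zero]
  intro η hη
  have hη4 : 0 < η / 4 := ENNReal.div_pos hη.ne' (by simp)
  obtain ⟨e, he0, heη⟩ := ENNReal.lt_iff_exists_nnreal_btwn.1 hη4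
  have hε : 0 < min ε' (e : ℝ) := lt_min hε' (by exact_mod_cast he0)
  set ε : ℝ := min ε' (e : ℝ)
  have hεε' : ε ≤ ε' := min_le_left _ _
  have hεη : ENNReal.ofReal ε ≤ η / 4 :=
    (ENNReal.ofReal_le_ofReal (min_le_right _ _)).trans
      ((ENNReal.ofReal_coe_nnreal (p := e)).le.trans heη.le)
  obtain ⟨δ, hδ, -, hreg⟩ := hur ε hε
  have hexit : ∀ᵐ ω ∂P, ∃ t, IsFirstExit (fun t => X t ω) Dinf t := by
    refine hX.ae_exists_isFirstExit (BM := BM) hoinf hneinf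
      (nonempty_frontier_iff.2 ⟨⟨z₀, hz₀inf⟩, hneinf⟩) fun a ha => ?_
    obtain ⟨b, hb, -, h⟩ := hur a ha
    exact ⟨b, hb, h Dinf (Or.inr rfl)⟩
  obtain ⟨N, hN⟩ := ((ENNReal.tendsto_nhds_zero.1
    (hX.tendsto_measure_not_exit_le hoinf hneinf hexit)) _ hη4).exists
  obtain ⟨R, hR⟩ := ((ENNReal.tendsto_nhds_zero.1
    (hX.tendsto_measure_exit_ball_le (Nat.cast_nonneg (α := ℝ) N))) _ hη4).exists
  filter_upwards [hconv.eventually_infDist_frontier_limit_lt R hδ,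
    hconv.eventually_infDist_frontier_lt hne hoinf hcinf hz₀inf R hδ] with n hn1 hn2
  have hGo : IsOpen (D n ∩ Dinf) := (hopen n).inter hoinf
  have hbad1 := hX.measure_not_exitsInto_ball_le hGo Set.inter_subset_right hoinf hneinf
    (hreg Dinf (Or.inr rfl))
  have hbad2 := hX.measure_not_exitsInto_ball_le hGo Set.inter_subset_left (hopen n) (hne n)
    (hreg (D n) (Or.inl ⟨n, rfl⟩))
  set A := {ω | ¬ ∃ s ≤ (N : ℝ), IsFirstExit (fun t => X t ω) Dinf s}
  set B := {ω | ∃ s ≤ (N : ℝ), IsFirstExit (fun t => X t ω) (Metric.ball 0 R) s}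
  set E := {ω | ∃ t, IsFirstExit (fun t => X t ω) (D n ∩ Dinf) t ∧
      (X t ω ∈ Dinf ∧ Metric.infDist (X t ω) (frontier Dinf) < δ) ∧
      ¬ exitsInto (fun t => X t ω) Dinf (Metric.ball (X t ω) ε)}
  set F := {ω | ∃ t, IsFirstExit (fun t => X t ω) (D n ∩ Dinf) t ∧
      (X t ω ∈ D n ∧ Metric.infDist (X t ω) (frontier (D n)) < δ) ∧
      ¬ exitsInto (fun t => X t ω) (D n) (Metric.ball (X t ω) ε)}
  have hsub : {ω | ε' ≤ dist (exitPoint (fun t => X t ω) (D n))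
      (exitPoint (fun t => X t ω) Dinf)} ⊆ A ∪ B ∪ (E ∪ F) := by
    intro ω hω
    rw [Set.mem_ofPred_eq] at hω
    by_contra hgood
    simp only [Set.mem_union, not_or] at hgood
    obtain ⟨⟨hA, hB⟩, hE, hF⟩ := hgood
    obtain ⟨τ, hτN, hτ⟩ := not_not.1 hA
    have hcont := hX.cont ω
    obtain ⟨σ, hστ, hσ⟩ := exists_isFirstExit_le hcont hGo hτ.1 (fun h => hτ.2.1 h.2)
    have hσR : ‖X σ ω‖ ≤ R := by
      by_contra hlt
      obtain ⟨s, hs, hs'⟩ := exists_isFirstExit_le hcont (Metric.isOpen_ball (x := (0 : ℂ))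
        (ε := (R : ℝ))) hσ.1 (fun h => hlt (mem_ball_zero_iff.1 h).le)
      exact hB ⟨s, hs.trans (hστ.trans hτN), hs'⟩
    refine absurd hω (not_le.2 ?_)
    by_cases h1 : X σ ω ∈ D n
    · have h2 : X σ ω ∉ Dinf := fun h2 => hσ.2.1 ⟨h1, h2⟩
      have hσinf := hσ.of_subset Set.inter_subset_right h2
      have hfr := hσinf.mem_frontier hcont hoinf ((hX.start ω).symm ▸ hz₀inf)
      rw [exitPoint_eq hcont hoinf hσinf]
      refine (dist_exitPoint_lt_of_exitsInto hcont (hopen n) ?_).trans_le hεε'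
      by_contra hnot
      exact hF ⟨σ, hσ, ⟨h1, hn2 _ hfr hσR h1⟩, hnot⟩
    · rw [exitPoint_eq hcont (hopen n) (hσ.of_subset Set.inter_subset_left h1)]
      by_cases h2 : X σ ω ∈ Dinf
      · rw [dist_comm]
        refine (dist_exitPoint_lt_of_exitsInto hcont hoinf ?_).trans_le hεε'
        by_contra hnot
        exact hE ⟨σ, hσ, ⟨h2, hn1 _ h2 hσR h1⟩, hnot⟩
      · rwa [exitPoint_eq hcont hoinf (hσ.of_subset Set.inter_subset_right h2), dist_self]
  calc P _ ≤ P (A ∪ B ∪ (E ∪ F)) := measure_mono hsub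
    _ ≤ (P A + P B) + (P E + P F) := (measure_union_le _ _).trans
        (add_le_add (measure_union_le _ _) (measure_union_le _ _))
    _ ≤ (η / 4 + η / 4) + (η / 4 + η / 4) :=
        add_le_add (add_le_add hN hR) (add_le_add (hbad1.trans hεη) (hbad2.trans hεη))
    _ = η := by
      rw [show (4 : ENNReal) = 2 * 2 by norm_num, ENNReal.div_eq_inv_mul,
        ENNReal.mul_inv (by simp) (by simp), mul_assoc, ← ENNReal.div_eq_inv_mul,
        ← ENNReal.div_eq_inv_mul, ENNReal.add_halves, ENNReal.add_halves]

theorem hmMeasure_eq_map {Ω : Type*} [MeasurableSpace Ω] {BM : PlanarBM Ω} {X : ℝ → Ω → ℂ} {z : ℂ}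
    (hae : ∀ᵐ ω ∂BM.P z, ∀ t, X t ω = BM.Z t ω) (D : Set ℂ) :
    hmMeasure BM D z = (BM.P z).map fun ω => exitPoint (fun t => X t ω) D := by
  refine Measure.map_congr ?_
  filter_upwards [hae] with ω hω
  simp only [hω]

/-- Weak convergence of harmonic measures under Carathéodory convergence of
uniformly regular domains. -/
theorem hm_weak_convergence {Ω : Type*} [MeasurableSpace Ω] (BM : PlanarBM Ω)
    (D : ℕ → Set ℂ) (Dinf : Set ℂ) (z₀ : ℂ)
    (hopen : ∀ n, IsOpen (D n)) (hconn : ∀ n, IsConnected (D n))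
    (hne : ∀ n, D n ≠ Set.univ)
    (hoinf : IsOpen Dinf) (hcinf : IsConnected Dinf) (hneinf : Dinf ≠ Set.univ)
    (hz₀ : ∀ n, z₀ ∈ D n) (hz₀inf : z₀ ∈ Dinf)
    (hur : UniformlyRegular BM (Set.range D ∪ {Dinf}))
    (hconv : KernelConvergesTo D Dinf z₀) :
    ∀ f : BoundedContinuousFunction ℂ ℝ,
      Tendsto (fun n => ∫ x, f x ∂hmMeasure BM (D n) z₀) atTop
        (nhds (∫ x, f x ∂hmMeasure BM Dinf z₀)) := by
  intro f
  have := BM.isProb z₀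
  obtain ⟨X, hX, hae⟩ := BM.exists_isPlanarBM z₀
  have hlim := (hX.tendstoInMeasure_exitPoint hopen hne hoinf hcinf hneinf hz₀inf hur
    hconv).tendstoInDistribution fun n =>
      (hX.measurable_exitPoint (hopen n) (Set.nonempty_compl.2 (hne n))).aemeasurable
  simp only [hmMeasure_eq_map hae]
  exact ProbabilityMeasure.tendsto_iff_forall_integral_tendsto.1 hlim.tendsto f
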